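/- Suppose (G_n, c_n) satisfies Assumption (LL) for some K > 1, γ_n > 0 and δ_n → 0, with G_n simple and c_n connected. Then |W̃_n| = (1 − O(√δ_n))|V(G_n)|, and for X uniform on V(G_n) and every fixed radius r, P(B_{WST(c_n)}(X, r) is not nice) → 0 as n → ∞. -/

import Mathlib

open MeasureTheory Filter Finset

noncomputable section

set_option linter.unusedSectionVars false

namespace WSTPaper

variable {V : Type} [Fintype V] [DecidableEq V]

/-- The conductance `C_v = Σ_{u ~ v} c(u,v)` of a vertex in the electric network `(G, c)`. -/
def vertCond (G : SimpleGraph V) [DecidableRel G.Adj] (c : Sym2 V → ℝ) (v : V) : ℝ :=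
  ∑ u ∈ G.neighborFinset v, c s(u, v)

open scoped Classical in
/-- The edge sets of spanning trees of `G`. -/
def spanningTrees (G : SimpleGraph V) : Finset (Finset (Sym2 V)) :=
  Finset.univ.filter
    (fun T => ↑T ⊆ G.edgeSet ∧ (SimpleGraph.fromEdgeSet (↑T : Set (Sym2 V))).IsTree)

/-- Weight of a spanning tree: product of its edge conductances. -/
def treeWeight (c : Sym2 V → ℝ) (T : Finset (Sym2 V)) : ℝ := ∏ e ∈ T, c e

/-- Partition function of the weighted spanning tree measure. -/
def partZ (G : SimpleGraph V) (c : Sym2 V → ℝ) : ℝ := ∑ T ∈ spanningTrees G, treeWeight c T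

/-- The ball of radius `r` around `x` in `G`, as a set of vertices. -/
def ballSet (G : SimpleGraph V) (x : V) (r : ℕ) : Set V :=
  {y | G.Reachable x y ∧ G.dist x y ≤ r}

/-- The Dirichlet energy of a function `h` on the electric network `(G, c)`. -/
def energy (G : SimpleGraph V) [DecidableRel G.Adj] (c : Sym2 V → ℝ) (h : V → ℝ) : ℝ :=
  (1 / 2) * ∑ v : V, ∑ u ∈ G.neighborFinset v, c s(u, v) * (h u - h v) ^ 2

/-- The effective conductance `C_eff(a ↔ b) = C_a · P_a(τ_b < τ_a⁺)` (Dirichlet's principle). -/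
def effCond (G : SimpleGraph V) [DecidableRel G.Adj] (c : Sym2 V → ℝ) (a b : V) : ℝ :=
  ⨅ h : {h : V → ℝ // h a = 1 ∧ h b = 0}, energy G c (h : V → ℝ)

/-- The effective resistance `R_eff(a ↔ b) = 1 / (C_a · P_a(τ_b < τ_a⁺))`. -/
def effRes (G : SimpleGraph V) [DecidableRel G.Adj] (c : Sym2 V → ℝ) (a b : V) : ℝ :=
  (effCond G c a b)⁻¹

/-- The set `Wₙ^{(tc)}` of vertices of typical conductance `C_v ∈ [γ, Kγ]`. -/
def typCond (G : SimpleGraph V) [DecidableRel G.Adj] (c : Sym2 V → ℝ) (γ K : ℝ) (v : V) :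
    Prop := vertCond G c v ∈ Set.Icc γ (K * γ)

open scoped Classical in
/-- `v` has typical neighbors:
`Σ_{u ~ v, (u,v) ∉ Eₙ(4/γ)} c(u,v)·R_eff(u↔v) + Σ_{u ∉ W^{(tc)}, u ~ v} c(u,v)/γ ≤ √δ`. -/
def typNbrs (G : SimpleGraph V) [DecidableRel G.Adj] (c : Sym2 V → ℝ) (γ K δ : ℝ) (v : V) :
    Prop :=
  (∑ u ∈ G.neighborFinset v,
      if effRes G c u v ≤ 4 / γ then 0 else c s(u, v) * effRes G c u v) +
    (∑ u ∈ (G.neighborFinset v).filter (fun u => ¬ typCond G c γ K u), c s(u, v) / γ)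
    ≤ Real.sqrt δ

/-- `W̃ₙ`: the set of vertices of typical conductance and with typical neighbors. -/
def goodVert (G : SimpleGraph V) [DecidableRel G.Adj] (c : Sym2 V → ℝ) (γ K δ : ℝ) (v : V) :
    Prop := typCond G c γ K v ∧ typNbrs G c γ K δ v

/-- A subgraph (given by its edge set `T` and realized as `fromEdgeSet T`) has a *nice*
`r`-ball around `x`: all vertices of the ball lie in `W̃ₙ`, and each of its edges `(y,z)`
satisfies `R_eff(y↔z) ≤ 4/γ` (i.e. lies in `Eₙ(4/γ)`). -/
def NiceBall (G : SimpleGraph V) [DecidableRel G.Adj] (c : Sym2 V → ℝ) (γ K δ : ℝ)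
    (T : Finset (Sym2 V)) (x : V) (r : ℕ) : Prop :=
  (∀ y ∈ ballSet (SimpleGraph.fromEdgeSet (↑T : Set (Sym2 V))) x r, goodVert G c γ K δ y) ∧
  (∀ y ∈ ballSet (SimpleGraph.fromEdgeSet (↑T : Set (Sym2 V))) x r,
   ∀ z ∈ ballSet (SimpleGraph.fromEdgeSet (↑T : Set (Sym2 V))) x r,
    (SimpleGraph.fromEdgeSet (↑T : Set (Sym2 V))).Adj y z → effRes G c y z ≤ 4 / γ)

open scoped Classical in
/-- `P(B_{WST(c)}(X, r)` is not nice`)`, for `X` a uniform random vertex. -/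
def wstNotNiceProb (G : SimpleGraph V) [DecidableRel G.Adj] (c : Sym2 V → ℝ) (γ K δ : ℝ)
    (r : ℕ) : ℝ :=
  (Fintype.card V : ℝ)⁻¹ *
    ∑ x : V, (∑ T ∈ spanningTrees G,
      if NiceBall G c γ K δ T x r then 0 else treeWeight c T) / partZ G c

/-- The graph on `V` spanned by a finite set of edges. -/
abbrev edgeGraph (T : Finset (Sym2 V)) : SimpleGraph V :=
  SimpleGraph.fromEdgeSet (↑T : Set (Sym2 V))

open scoped Classical in
/-- The indicator of `a` and `x` being connected by the edges in `Φ`. -/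
def connInd (Φ : Finset (Sym2 V)) (a x : V) : ℝ := if (edgeGraph Φ).Reachable a x then 1 else 0

theorem mem_spanningTrees {G : SimpleGraph V} {T : Finset (Sym2 V)} :
    T ∈ spanningTrees G ↔ (↑T : Set (Sym2 V)) ⊆ G.edgeSet ∧ (edgeGraph T).IsTree := by
  simp [spanningTrees]

theorem adj_of_mem_spanningTrees {G : SimpleGraph V} {T : Finset (Sym2 V)}
    (hT : T ∈ spanningTrees G) {x y : V} (h : s(x, y) ∈ T) : G.Adj x y :=
  (mem_spanningTrees.1 hT).1 h

theorem edgeGraph_insert (Φ : Finset (Sym2 V)) (e : Sym2 V) :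
    edgeGraph (insert e Φ) = edgeGraph Φ ⊔ SimpleGraph.fromEdgeSet {e} := by
  rw [edgeGraph, edgeGraph, Finset.coe_insert, Set.insert_eq, Set.union_comm,
    SimpleGraph.fromEdgeSet_union]

theorem reachable_insert {Φ : Finset (Sym2 V)} {a b v w : V}
    (h : (edgeGraph (insert s(a, b) Φ)).Reachable v w) :
    (edgeGraph Φ).Reachable v w ∨
      ((edgeGraph Φ).Reachable a v ∨ (edgeGraph Φ).Reachable b v) ∧
      ((edgeGraph Φ).Reachable a w ∨ (edgeGraph Φ).Reachable b w) := by
  obtain ⟨p⟩ := h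
  induction p with
  | nil => exact Or.inl .rfl
  | @cons u v w h p ih =>
    rw [SimpleGraph.fromEdgeSet_adj] at h
    obtain ⟨h1, h2⟩ := h
    rw [Finset.coe_insert, Set.mem_insert_iff] at h1
    rcases h1 with h1 | h1
    · have huv : u = a ∧ v = b ∨ u = b ∧ v = a := by simpa using h1
      have hu : (edgeGraph Φ).Reachable a u ∨ (edgeGraph Φ).Reachable b u := by
        rcases huv with ⟨rfl, rfl⟩ | ⟨rfl, rfl⟩
        · exact Or.inl .rfl
        · exact Or.inr .rfl
      refine Or.inr ⟨hu, ?_⟩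
      rcases ih with ih | ih
      · rcases huv with ⟨rfl, rfl⟩ | ⟨rfl, rfl⟩
        · exact Or.inr ih
        · exact Or.inl ih
      · exact ih.2
    · have huv : (edgeGraph Φ).Reachable u v :=
        SimpleGraph.Adj.reachable (by rw [SimpleGraph.fromEdgeSet_adj]; exact ⟨h1, h2⟩)
      rcases ih with ih | ih
      · exact Or.inl (huv.trans ih)
      · exact Or.inr ⟨ih.1.imp (fun h => h.trans huv.symm) (fun h => h.trans huv.symm), ih.2⟩

theorem insert_mem_spanningTrees_iff {G : SimpleGraph V} {Φ : Finset (Sym2 V)} {a b : V}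
    (hab : G.Adj a b) :
    s(a, b) ∉ Φ ∧ insert s(a, b) Φ ∈ spanningTrees G ↔
      (↑Φ : Set (Sym2 V)) ⊆ G.edgeSet ∧ (edgeGraph Φ).IsAcyclic ∧ ¬ (edgeGraph Φ).Reachable a b ∧
        ∀ v, (edgeGraph Φ).Reachable a v ∨ (edgeGraph Φ).Reachable b v := by
  have hadj : (edgeGraph (insert s(a, b) Φ)).Adj a b := by
    rw [SimpleGraph.fromEdgeSet_adj]; exact ⟨by simp, hab.ne⟩
  constructor
  · rintro ⟨hn, hT⟩
    obtain ⟨h1, h2⟩ := mem_spanningTrees.1 hT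
    have hle : edgeGraph Φ ≤ edgeGraph (insert s(a, b) Φ) := by
      rw [edgeGraph_insert]; exact le_sup_left
    refine ⟨fun e he => h1 (by simpa using Or.inr he), h2.isAcyclic.anti hle, ?_, ?_⟩
    · have := SimpleGraph.isAcyclic_iff_forall_adj_isBridge.1 h2.isAcyclic hadj
      rw [SimpleGraph.isBridge_iff] at this
      refine fun h => this (h.mono ?_)
      intro x y hxy
      rw [SimpleGraph.deleteEdges_adj]
      refine ⟨hle hxy, ?_⟩
      rw [SimpleGraph.fromEdgeSet_adj] at hxy
      rintro h
      rw [Set.mem_singleton_iff] at h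
      exact hn (h ▸ hxy.1)
    · intro v
      rcases reachable_insert (h2.connected.preconnected a v) with h | h
      · exact Or.inl h
      · exact h.2
  · rintro ⟨h1, h2, h3, h4⟩
    refine ⟨fun h => h3 (SimpleGraph.Adj.reachable ?_), ?_⟩
    · rw [SimpleGraph.fromEdgeSet_adj]; exact ⟨h, hab.ne⟩
    rw [mem_spanningTrees]
    refine ⟨?_, ?_, ?_⟩
    · intro e he
      rw [Finset.coe_insert, Set.mem_insert_iff] at he
      rcases he with rfl | he
      · exact hab
      · exact h1 he
    · have hle : edgeGraph Φ ≤ edgeGraph (insert s(a, b) Φ) := by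
        rw [edgeGraph_insert]; exact le_sup_left
      have : ∀ v, (edgeGraph (insert s(a, b) Φ)).Reachable a v := fun v => by
        rcases h4 v with h | h
        · exact h.mono hle
        · exact hadj.reachable.trans (h.mono hle)
      have hne : Nonempty V := ⟨a⟩
      exact ⟨fun u v => (this u).symm.trans (this v)⟩
    · rw [edgeGraph_insert]
      exact (SimpleGraph.isAcyclic_add_edge_iff_of_not_reachable a b h3).2 h2

theorem insert_swap {G : SimpleGraph V} {Φ : Finset (Sym2 V)} {a b x y : V}
    (hab : G.Adj a b) (hxy : G.Adj x y)
    (h : s(a, b) ∉ Φ ∧ insert s(a, b) Φ ∈ spanningTrees G)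
    (hne : connInd Φ a x - connInd Φ a y ≠ 0) :
    (s(x, y) ∉ Φ ∧ insert s(x, y) Φ ∈ spanningTrees G) ∧
      connInd Φ a x - connInd Φ a y = connInd Φ x a - connInd Φ x b := by
  rw [insert_mem_spanningTrees_iff hab] at h
  rw [insert_mem_spanningTrees_iff hxy]
  obtain ⟨h1, h2, h3, h4⟩ := h
  have hx := h4 x
  have hy := h4 y
  by_cases hax : (edgeGraph Φ).Reachable a x <;> by_cases hay : (edgeGraph Φ).Reachable a y
  · simp [connInd, hax, hay] at hne
  · have hby := hy.resolve_left hay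
    have hxb : ¬ (edgeGraph Φ).Reachable x b := fun h => h3 (hax.trans h)
    refine ⟨⟨h1, h2, fun h => hay (hax.trans h), fun v => ?_⟩, ?_⟩
    · exact (h4 v).imp (fun h => hax.symm.trans h) (fun h => hby.symm.trans h)
    · simp [connInd, hax, hay, hax.symm, hxb]
  · have hbx := hx.resolve_left hax
    have hxa : ¬ (edgeGraph Φ).Reachable x a := fun h => hax h.symm
    refine ⟨⟨h1, h2, fun h => hax (hay.trans h.symm), fun v => ?_⟩, ?_⟩
    · exact (h4 v).symm.imp (fun h => hbx.symm.trans h) (fun h => hay.symm.trans h)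
    · simp [connInd, hax, hay, hbx.symm, hxa]
  · simp [connInd, hax, hay] at hne

open scoped Classical in
theorem insert_swap_ite {G : SimpleGraph V} (Φ : Finset (Sym2 V)) {a b x y : V}
    (hab : G.Adj a b) (hxy : G.Adj x y) :
    (if s(a, b) ∉ Φ ∧ insert s(a, b) Φ ∈ spanningTrees G
      then connInd Φ a x - connInd Φ a y else 0) =
    (if s(x, y) ∉ Φ ∧ insert s(x, y) Φ ∈ spanningTrees G
      then connInd Φ x a - connInd Φ x b else 0) := by
  by_cases h : s(a, b) ∉ Φ ∧ insert s(a, b) Φ ∈ spanningTrees G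
  · rw [if_pos h]
    by_cases hne : connInd Φ a x - connInd Φ a y = 0
    · rw [hne]
      split_ifs with h'
      · by_contra hne'
        exact (Ne.symm hne') ((insert_swap hxy hab h' (Ne.symm hne')).2.trans hne)
      · rfl
    · obtain ⟨h', e⟩ := insert_swap hab hxy h hne
      rw [if_pos h', e]
  · rw [if_neg h]
    split_ifs with h'
    · by_contra hne'
      exact h (insert_swap hxy hab h' (Ne.symm hne')).1
    · rfl

theorem erase_tree {G : SimpleGraph V} {T : Finset (Sym2 V)} (hT : T ∈ spanningTrees G) {a b : V}
    (h : s(a, b) ∈ T) : ¬ (edgeGraph (T.erase s(a, b))).Reachable a b := by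
  have hab := adj_of_mem_spanningTrees hT h
  exact ((insert_mem_spanningTrees_iff (Φ := T.erase s(a, b)) hab).1
    ⟨by simp, by rwa [Finset.insert_erase h]⟩).2.2.1

theorem connInd_self (Φ : Finset (Sym2 V)) (a : V) : connInd Φ a a = 1 := by
  simp [connInd]

theorem connInd_congr {Φ : Finset (Sym2 V)} {x y : V} (h : s(x, y) ∈ Φ) (a : V) :
    connInd Φ a x = connInd Φ a y := by
  by_cases hxy : x = y
  · rw [hxy]
  have hr : (edgeGraph Φ).Reachable x y :=
    SimpleGraph.Adj.reachable (by rw [SimpleGraph.fromEdgeSet_adj]; exact ⟨h, hxy⟩)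
  have : (edgeGraph Φ).Reachable a x ↔ (edgeGraph Φ).Reachable a y :=
    ⟨fun h => h.trans hr, fun h => h.trans hr.symm⟩
  simp [connInd, this]

theorem sum_connInd_tree_of_adj {G : SimpleGraph V} {T : Finset (Sym2 V)}
    (hT : T ∈ spanningTrees G) (g : V → ℝ) {a b : V} (h : s(a, b) ∈ T) :
    ∑ x, ∑ y, (if s(x, y) ∈ T then (connInd (T.erase s(x, y)) x a - connInd (T.erase s(x, y)) x b)
      * (g x - g y) else 0) = 2 * (g a - g b) := by
  have hab := adj_of_mem_spanningTrees hT h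
  have key : ∀ x y, (if s(x, y) ∈ T then
      (connInd (T.erase s(x, y)) x a - connInd (T.erase s(x, y)) x b) * (g x - g y) else 0) =
      (if x = a then if y = b then g a - g b else 0 else 0) +
      (if x = b then if y = a then g a - g b else 0 else 0) := by
    intro x y
    by_cases hxy : s(x, y) = s(a, b)
    · have hr : connInd (T.erase s(a, b)) a b = 0 := by simp [connInd, erase_tree hT h]
      have hr' : connInd (T.erase s(a, b)) b a = 0 := by
        have := erase_tree hT h
        rw [SimpleGraph.reachable_comm] at this
        simp [connInd, this]
      rw [hxy, if_pos h]
      rcases (by simpa using hxy : x = a ∧ y = b ∨ x = b ∧ y = a) with ⟨rfl, rfl⟩ | ⟨rfl, rfl⟩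
      · simp [connInd_self, hr, hab.ne]
      · simp [connInd_self, hr', hab.ne']
    · have h1 : ¬ (x = a ∧ y = b) := fun h' => hxy (by rw [h'.1, h'.2])
      have h2 : ¬ (x = b ∧ y = a) := fun h' => hxy (by rw [h'.1, h'.2, Sym2.eq_swap])
      have hmem : s(a, b) ∈ T.erase s(x, y) := Finset.mem_erase.2 ⟨Ne.symm hxy, h⟩
      rw [connInd_congr hmem x, sub_self, zero_mul, ite_self]
      rw [← ite_and, ← ite_and, if_neg h1, if_neg h2, add_zero]
  simp_rw [key, Finset.sum_add_distrib]
  simp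
  ring

/-- In a spanning tree, increments of `g` telescope along the path from `a` to `b`. -/
theorem sum_connInd_tree {G : SimpleGraph V} {T : Finset (Sym2 V)}
    (hT : T ∈ spanningTrees G) (g : V → ℝ) (a b : V) :
    ∑ x, ∑ y, (if s(x, y) ∈ T then (connInd (T.erase s(x, y)) x a - connInd (T.erase s(x, y)) x b)
      * (g x - g y) else 0) = 2 * (g a - g b) := by
  obtain ⟨p⟩ := (mem_spanningTrees.1 hT).2.connected.preconnected a b
  induction p with
  | nil => simp
  | @cons u v w h p ih =>
    have h' : s(u, v) ∈ T := (SimpleGraph.fromEdgeSet_adj _).1 h |>.1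
    have h1 := sum_connInd_tree_of_adj hT g h'
    have : 2 * (g u - g w) = 2 * (g u - g v) + 2 * (g v - g w) := by ring
    rw [this, ← h1, ← ih, ← Finset.sum_add_distrib]
    refine Finset.sum_congr rfl fun x _ => ?_
    rw [← Finset.sum_add_distrib]
    refine Finset.sum_congr rfl fun y _ => ?_
    split_ifs <;> ring

/-- Total weight of the spanning trees that contain the edge set `F`. -/
def treeSum (G : SimpleGraph V) (c : Sym2 V → ℝ) (F : Finset (Sym2 V)) : ℝ :=
  ∑ T ∈ spanningTrees G, if F ⊆ T then treeWeight c T else 0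

open scoped Classical in
/-- The unnormalised voltage between `a` and `b`: the weight of the two-component spanning forests
containing `F` that separate `a` from `b` and connect `x` to `a`. -/
def forestPot (G : SimpleGraph V) (c : Sym2 V → ℝ) (F : Finset (Sym2 V)) (a b x : V) : ℝ :=
  ∑ Φ : Finset (Sym2 V), if s(a, b) ∉ Φ ∧ insert s(a, b) Φ ∈ spanningTrees G then
    (if F ⊆ Φ then treeWeight c Φ * connInd Φ a x else 0) else 0

/-- The bilinear form polarizing the Dirichlet energy. -/
def dirForm (G : SimpleGraph V) [DecidableRel G.Adj] (c : Sym2 V → ℝ) (h g : V → ℝ) : ℝ :=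
  (1 / 2) * ∑ v : V, ∑ u ∈ G.neighborFinset v, c s(u, v) * ((h u - h v) * (g u - g v))

open scoped Classical in
theorem sum_insert_tree (G : SimpleGraph V) (f : Sym2 V) (Q : Finset (Sym2 V) → ℝ) :
    (∑ Φ : Finset (Sym2 V), if f ∉ Φ ∧ insert f Φ ∈ spanningTrees G then Q Φ else 0) =
      ∑ T ∈ spanningTrees G, if f ∈ T then Q (T.erase f) else 0 := by
  rw [← Finset.sum_filter, ← Finset.sum_filter]
  refine Finset.sum_nbij' (fun Φ => insert f Φ) (fun T => T.erase f) ?_ ?_ ?_ ?_ ?_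
  · intro Φ hΦ
    simp only [Finset.mem_filter, Finset.mem_univ, true_and] at hΦ ⊢
    exact ⟨hΦ.2, by simp⟩
  · intro T hT
    simp only [Finset.mem_filter, Finset.mem_univ, true_and] at hT ⊢
    exact ⟨by simp, by rw [Finset.insert_erase hT.2]; exact hT.1⟩
  · intro Φ hΦ
    simp only [Finset.mem_filter, Finset.mem_univ, true_and] at hΦ
    exact Finset.erase_insert hΦ.1
  · intro T hT
    simp only [Finset.mem_filter] at hT
    exact Finset.insert_erase hT.2
  · intro Φ hΦ
    simp only [Finset.mem_filter, Finset.mem_univ, true_and] at hΦ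
    rw [Finset.erase_insert hΦ.1]

theorem treeWeight_erase (c : Sym2 V → ℝ) {T : Finset (Sym2 V)} {f : Sym2 V} (h : f ∈ T) :
    c f * treeWeight c (T.erase f) = treeWeight c T := by
  simpa [treeWeight] using Finset.mul_prod_erase T c h

theorem forestPot_edge (G : SimpleGraph V) (c : Sym2 V → ℝ) {F : Finset (Sym2 V)} {a b u v : V}
    (hab : G.Adj a b) (huv : G.Adj u v) (g : V → ℝ) (hg : ∀ x y, s(x, y) ∈ F → g x = g y) :
    c s(u, v) * ((forestPot G c F a b u - forestPot G c F a b v) * (g u - g v)) =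
      ∑ T ∈ spanningTrees G, if F ⊆ T then treeWeight c T * (if s(u, v) ∈ T then
        (connInd (T.erase s(u, v)) u a - connInd (T.erase s(u, v)) u b) * (g u - g v) else 0)
        else 0 := by
  classical
  have h1 : forestPot G c F a b u - forestPot G c F a b v =
      ∑ T ∈ spanningTrees G, if s(u, v) ∈ T then
        (if F ⊆ T.erase s(u, v) then treeWeight c (T.erase s(u, v)) *
          (connInd (T.erase s(u, v)) u a - connInd (T.erase s(u, v)) u b) else 0) else 0 := by
    rw [← sum_insert_tree G s(u, v) (fun Φ => if F ⊆ Φ then treeWeight c Φ *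
      (connInd Φ u a - connInd Φ u b) else 0), forestPot, forestPot, ← Finset.sum_sub_distrib]
    refine Finset.sum_congr rfl fun Φ _ => ?_
    have := insert_swap_ite (G := G) Φ hab huv
    by_cases hF : F ⊆ Φ
    · simp only [hF, if_true]
      have h2 := congrArg (fun t => treeWeight c Φ * t) this
      simp only [mul_ite, mul_zero] at h2
      rw [← h2]
      split_ifs <;> ring
    · simp [hF]
  rw [h1, Finset.sum_mul, Finset.mul_sum]
  refine Finset.sum_congr rfl fun T hT => ?_
  by_cases hm : s(u, v) ∈ T
  · by_cases hF : F ⊆ T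
    · by_cases huF : s(u, v) ∈ F
      · simp [hg u v huF]
      · have : F ⊆ T.erase s(u, v) := Finset.subset_erase.2 ⟨hF, huF⟩
        simp only [hm, hF, this, if_true]
        rw [← treeWeight_erase c hm]
        ring
    · have : ¬ F ⊆ T.erase s(u, v) := fun h => hF (h.trans (Finset.erase_subset _ _))
      simp [hF, this]
  · simp [hm]

theorem dirForm_forestPot (G : SimpleGraph V) [DecidableRel G.Adj] (c : Sym2 V → ℝ)
    {F : Finset (Sym2 V)} {a b : V} (hab : G.Adj a b) (g : V → ℝ)
    (hg : ∀ x y, s(x, y) ∈ F → g x = g y) :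
    dirForm G c (forestPot G c F a b) g = treeSum G c F * (g a - g b) := by
  have h1 : ∀ v, ∑ u ∈ G.neighborFinset v, c s(u, v) *
      ((forestPot G c F a b u - forestPot G c F a b v) * (g u - g v)) =
      ∑ u, ∑ T ∈ spanningTrees G, if F ⊆ T then treeWeight c T * (if s(u, v) ∈ T then
        (connInd (T.erase s(u, v)) u a - connInd (T.erase s(u, v)) u b) * (g u - g v) else 0)
        else 0 := by
    intro v
    rw [← Finset.sum_subset (Finset.subset_univ (G.neighborFinset v))]
    · refine Finset.sum_congr rfl fun u hu => ?_
      exact forestPot_edge G c hab ((G.mem_neighborFinset v u).1 hu).symm g hg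
    · intro u _ hu
      refine Finset.sum_eq_zero fun T hT => ?_
      have : s(u, v) ∉ T := fun h =>
        hu ((G.mem_neighborFinset v u).2 (adj_of_mem_spanningTrees hT h).symm)
      simp [this]
  rw [dirForm, Finset.sum_congr rfl fun v _ => h1 v, Finset.sum_comm]
  have h2 : ∀ u, ∑ v, ∑ T ∈ spanningTrees G, (if F ⊆ T then treeWeight c T *
      (if s(u, v) ∈ T then (connInd (T.erase s(u, v)) u a - connInd (T.erase s(u, v)) u b) *
        (g u - g v) else 0) else 0) = ∑ T ∈ spanningTrees G, ∑ v, (if F ⊆ T then treeWeight c T *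
      (if s(u, v) ∈ T then (connInd (T.erase s(u, v)) u a - connInd (T.erase s(u, v)) u b) *
        (g u - g v) else 0) else 0) := fun u => Finset.sum_comm
  rw [Finset.sum_congr rfl fun u _ => h2 u, Finset.sum_comm, treeSum, Finset.sum_mul,
    Finset.mul_sum]
  refine Finset.sum_congr rfl fun T hT => ?_
  by_cases hF : F ⊆ T
  · simp only [hF, if_true]
    simp_rw [← Finset.mul_sum]
    rw [sum_connInd_tree hT g a b]
    ring
  · simp [hF]

theorem treeWeight_pos {G : SimpleGraph V} {c : Sym2 V → ℝ} (hpos : ∀ e ∈ G.edgeSet, 0 < c e)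
    {Φ : Finset (Sym2 V)} (h : (↑Φ : Set (Sym2 V)) ⊆ G.edgeSet) : 0 < treeWeight c Φ :=
  Finset.prod_pos fun e he => hpos e (h he)

theorem treeSum_nonneg {G : SimpleGraph V} {c : Sym2 V → ℝ} (hpos : ∀ e ∈ G.edgeSet, 0 < c e)
    (F : Finset (Sym2 V)) : 0 ≤ treeSum G c F := by
  refine Finset.sum_nonneg fun T hT => ?_
  split_ifs
  · exact (treeWeight_pos hpos (mem_spanningTrees.1 hT).1).le
  · exact le_rfl

theorem treeSum_empty (G : SimpleGraph V) (c : Sym2 V → ℝ) : treeSum G c ∅ = partZ G c := by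
  simp [treeSum, partZ]

theorem partZ_pos {G : SimpleGraph V} {c : Sym2 V → ℝ} (hpos : ∀ e ∈ G.edgeSet, 0 < c e)
    (hconn : G.Connected) : 0 < partZ G c := by
  classical
  obtain ⟨T, hle, hT⟩ := hconn.exists_isTree_le
  refine Finset.sum_pos (fun T hT => treeWeight_pos hpos (mem_spanningTrees.1 hT).1)
    ⟨T.edgeFinset, ?_⟩
  rw [mem_spanningTrees]
  refine ⟨?_, ?_⟩
  · rw [SimpleGraph.coe_edgeFinset]
    exact SimpleGraph.edgeSet_mono hle
  · rw [edgeGraph, SimpleGraph.coe_edgeFinset, SimpleGraph.fromEdgeSet_edgeSet]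
    exact hT

theorem forestPot_right (G : SimpleGraph V) (c : Sym2 V → ℝ) (F : Finset (Sym2 V)) {a b : V}
    (hab : G.Adj a b) : forestPot G c F a b b = 0 := by
  refine Finset.sum_eq_zero fun Φ _ => ?_
  split_ifs with h h'
  · have := ((insert_mem_spanningTrees_iff hab).1 h).2.2.1
    simp [connInd, this]
  · rfl
  · rfl

theorem forestPot_congr (G : SimpleGraph V) (c : Sym2 V → ℝ) {F : Finset (Sym2 V)} (a b : V)
    {x y : V} (h : s(x, y) ∈ F) : forestPot G c F a b x = forestPot G c F a b y := by
  refine Finset.sum_congr rfl fun Φ _ => ?_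
  split_ifs with _ h'
  · rw [connInd_congr (h' h) a]
  · rfl
  · rfl

theorem forestPot_nonneg {G : SimpleGraph V} {c : Sym2 V → ℝ} (hpos : ∀ e ∈ G.edgeSet, 0 < c e)
    (F : Finset (Sym2 V)) {a b : V} (hab : G.Adj a b) (x : V) : 0 ≤ forestPot G c F a b x := by
  refine Finset.sum_nonneg fun Φ _ => ?_
  split_ifs with h _
  · have h1 := treeWeight_pos hpos ((insert_mem_spanningTrees_iff hab).1 h).1
    refine mul_nonneg h1.le ?_
    unfold connInd
    split_ifs <;> norm_num
  · exact le_rfl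
  · exact le_rfl

theorem forestPot_le_left {G : SimpleGraph V} {c : Sym2 V → ℝ} (hpos : ∀ e ∈ G.edgeSet, 0 < c e)
    (F : Finset (Sym2 V)) {a b : V} (hab : G.Adj a b) (x : V) :
    forestPot G c F a b x ≤ forestPot G c F a b a := by
  refine Finset.sum_le_sum fun Φ _ => ?_
  split_ifs with h _
  · have h1 := treeWeight_pos hpos ((insert_mem_spanningTrees_iff hab).1 h).1
    refine mul_le_mul_of_nonneg_left ?_ h1.le
    rw [connInd_self]
    unfold connInd
    split_ifs <;> norm_num
  · exact le_rfl
  · exact le_rfl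

theorem forestPot_left (G : SimpleGraph V) (c : Sym2 V → ℝ) {F : Finset (Sym2 V)} {a b : V}
    (hF : s(a, b) ∉ F) :
    c s(a, b) * forestPot G c F a b a = treeSum G c (insert s(a, b) F) := by
  rw [forestPot, sum_insert_tree G s(a, b)
    (fun Φ => if F ⊆ Φ then treeWeight c Φ * connInd Φ a a else 0), treeSum, Finset.mul_sum]
  refine Finset.sum_congr rfl fun T _ => ?_
  simp only [Finset.insert_subset_iff, Finset.subset_erase, connInd_self, mul_one]
  by_cases h : s(a, b) ∈ T
  · simp only [h, true_and, if_true, hF, not_false_eq_true, and_true]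
    split_ifs
    · exact treeWeight_erase c h
    · simp
  · simp [h]

theorem energy_nonneg {G : SimpleGraph V} [DecidableRel G.Adj] {c : Sym2 V → ℝ}
    (hpos : ∀ e ∈ G.edgeSet, 0 < c e) (h : V → ℝ) : 0 ≤ energy G c h := by
  refine mul_nonneg (by norm_num) (Finset.sum_nonneg fun v _ => Finset.sum_nonneg fun u hu => ?_)
  exact mul_nonneg (hpos _ ((G.mem_neighborFinset v u).1 hu).symm).le (sq_nonneg _)

theorem energy_sub_smul (G : SimpleGraph V) [DecidableRel G.Adj] (c : Sym2 V → ℝ)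
    (h g : V → ℝ) (t : ℝ) :
    energy G c (fun v => g v - t * h v) =
      energy G c g - 2 * t * dirForm G c h g + t ^ 2 * dirForm G c h h := by
  simp only [energy, dirForm]
  rw [show ∀ A B C : ℝ, 1 / 2 * A - 2 * t * (1 / 2 * B) + t ^ 2 * (1 / 2 * C) =
    1 / 2 * (A - 2 * t * B + t ^ 2 * C) by intros; ring]
  congr 1
  rw [Finset.mul_sum, Finset.mul_sum, ← Finset.sum_sub_distrib, ← Finset.sum_add_distrib]
  refine Finset.sum_congr rfl fun v _ => ?_
  rw [Finset.mul_sum, Finset.mul_sum, ← Finset.sum_sub_distrib, ← Finset.sum_add_distrib]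
  refine Finset.sum_congr rfl fun u _ => ?_
  ring

theorem dirForm_forestPot_self (G : SimpleGraph V) [DecidableRel G.Adj] (c : Sym2 V → ℝ)
    (F : Finset (Sym2 V)) {a b : V} (hab : G.Adj a b) :
    dirForm G c (forestPot G c F a b) (forestPot G c F a b) =
      treeSum G c F * forestPot G c F a b a := by
  rw [dirForm_forestPot G c hab _ (fun x y h => forestPot_congr G c a b h),
    forestPot_right G c F hab, sub_zero]

theorem effCond_le_energy {G : SimpleGraph V} [DecidableRel G.Adj] {c : Sym2 V → ℝ}
    (hpos : ∀ e ∈ G.edgeSet, 0 < c e) {a b : V} (h : V → ℝ) (ha : h a = 1) (hb : h b = 0) :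
    effCond G c a b ≤ energy G c h :=
  ciInf_le (f := fun h : {h : V → ℝ // h a = 1 ∧ h b = 0} => energy G c (h : V → ℝ))
    ⟨0, by rintro _ ⟨x, rfl⟩; exact energy_nonneg hpos _⟩ ⟨h, ha, hb⟩

theorem effCond_le_div {G : SimpleGraph V} [DecidableRel G.Adj] {c : Sym2 V → ℝ}
    (hpos : ∀ e ∈ G.edgeSet, 0 < c e) (F : Finset (Sym2 V)) {a b : V} (hab : G.Adj a b)
    (hU : 0 < forestPot G c F a b a) :
    effCond G c a b ≤ treeSum G c F / forestPot G c F a b a := by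
  set U := forestPot G c F a b with hUdef
  refine (effCond_le_energy hpos (fun x => 0 - (-(U a)⁻¹) * U x) ?_ ?_).trans (le_of_eq ?_)
  · field_simp; ring
  · simp [hUdef, forestPot_right G c F hab]
  · rw [energy_sub_smul G c U (fun _ => 0), hUdef, dirForm_forestPot_self G c F hab, ← hUdef]
    simp only [energy, dirForm, sub_self]
    field_simp
    simp

theorem forestPot_empty_pos {G : SimpleGraph V} [DecidableRel G.Adj] {c : Sym2 V → ℝ}
    (hpos : ∀ e ∈ G.edgeSet, 0 < c e) (hconn : G.Connected) {a b : V} (hab : G.Adj a b) :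
    0 < forestPot G c ∅ a b a := by
  refine lt_of_le_of_ne (forestPot_nonneg hpos ∅ hab a) fun h0 => ?_
  have hz : ∀ x, forestPot G c ∅ a b x = 0 := fun x =>
    le_antisymm (h0 ▸ forestPot_le_left hpos ∅ hab x) (forestPot_nonneg hpos ∅ hab x)
  have h1 := dirForm_forestPot G c (F := ∅) hab (fun x => if x = a then 1 else 0) (by simp)
  simp only [dirForm, hz, treeSum_empty, hab.ne'] at h1
  have := partZ_pos hpos hconn
  simp at h1
  exact this.ne h1

theorem div_le_effCond {G : SimpleGraph V} [DecidableRel G.Adj] {c : Sym2 V → ℝ}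
    (hpos : ∀ e ∈ G.edgeSet, 0 < c e) (hconn : G.Connected) {a b : V} (hab : G.Adj a b) :
    partZ G c / forestPot G c ∅ a b a ≤ effCond G c a b := by
  have hU := forestPot_empty_pos hpos hconn hab
  have : Nonempty {h : V → ℝ // h a = 1 ∧ h b = 0} :=
    ⟨fun x => if x = a then 1 else 0, by simp, by simp [hab.ne']⟩
  refine le_ciInf fun ⟨g, ga, gb⟩ => ?_
  have h1 := energy_nonneg hpos
    (fun v => g v - (forestPot G c ∅ a b a)⁻¹ * forestPot G c ∅ a b v)
  rw [energy_sub_smul, dirForm_forestPot_self G c ∅ hab,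
    dirForm_forestPot G c hab g (by simp), ga, gb, treeSum_empty] at h1
  have h2 : (forestPot G c ∅ a b a)⁻¹ ^ 2 * (partZ G c * forestPot G c ∅ a b a) =
    partZ G c / forestPot G c ∅ a b a := by field_simp
  have h3 : 2 * (forestPot G c ∅ a b a)⁻¹ * (partZ G c * (1 - 0)) =
    2 * (partZ G c / forestPot G c ∅ a b a) := by field_simp; ring
  rw [h2, h3] at h1
  show _ ≤ energy G c g
  linarith

theorem effCond_eq_div {G : SimpleGraph V} [DecidableRel G.Adj] {c : Sym2 V → ℝ}
    (hpos : ∀ e ∈ G.edgeSet, 0 < c e) (hconn : G.Connected) {a b : V} (hab : G.Adj a b) :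
    effCond G c a b = partZ G c / forestPot G c ∅ a b a := by
  refine le_antisymm ?_ (div_le_effCond hpos hconn hab)
  rw [← treeSum_empty]
  exact effCond_le_div hpos ∅ hab (forestPot_empty_pos hpos hconn hab)

theorem effCond_pos {G : SimpleGraph V} [DecidableRel G.Adj] {c : Sym2 V → ℝ}
    (hpos : ∀ e ∈ G.edgeSet, 0 < c e) (hconn : G.Connected) {a b : V} (hab : G.Adj a b) :
    0 < effCond G c a b := by
  rw [effCond_eq_div hpos hconn hab]
  exact div_pos (partZ_pos hpos hconn) (forestPot_empty_pos hpos hconn hab)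

/-- Kirchhoff's formula: `c(e) R_eff(e)` is the probability that `e` is in the spanning tree. -/
theorem mul_effRes_eq {G : SimpleGraph V} [DecidableRel G.Adj] {c : Sym2 V → ℝ}
    (hpos : ∀ e ∈ G.edgeSet, 0 < c e) (hconn : G.Connected) {a b : V} (hab : G.Adj a b) :
    c s(a, b) * effRes G c a b = treeSum G c {s(a, b)} / partZ G c := by
  rw [effRes, effCond_eq_div hpos hconn hab, inv_div, ← mul_div_assoc,
    forestPot_left G c (by simp)]
  simp

theorem effRes_symm {G : SimpleGraph V} [DecidableRel G.Adj] {c : Sym2 V → ℝ}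
    (hpos : ∀ e ∈ G.edgeSet, 0 < c e) (hconn : G.Connected) {a b : V} (hab : G.Adj a b) :
    effRes G c a b = effRes G c b a := by
  have h1 := mul_effRes_eq hpos hconn hab
  have h2 := mul_effRes_eq hpos hconn hab.symm
  rw [Sym2.eq_swap, ← h1, Sym2.eq_swap] at h2
  exact (mul_left_cancel₀ (hpos s(b, a) hab.symm).ne' h2).symm

theorem effRes_pos {G : SimpleGraph V} [DecidableRel G.Adj] {c : Sym2 V → ℝ}
    (hpos : ∀ e ∈ G.edgeSet, 0 < c e) (hconn : G.Connected) {a b : V} (hab : G.Adj a b) :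
    0 < effRes G c a b := inv_pos.2 (effCond_pos hpos hconn hab)

/-- Negative correlation: conditioning on containing `F` does not increase the probability of
containing a further edge. -/
theorem treeSum_insert_le {G : SimpleGraph V} [DecidableRel G.Adj] {c : Sym2 V → ℝ}
    (hpos : ∀ e ∈ G.edgeSet, 0 < c e) (hconn : G.Connected) {F : Finset (Sym2 V)} {a b : V}
    (hab : G.Adj a b) (hF : s(a, b) ∉ F) :
    treeSum G c (insert s(a, b) F) ≤ treeSum G c F * (c s(a, b) * effRes G c a b) := by
  rw [← forestPot_left G c hF]
  have hR := effRes_pos hpos hconn hab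
  have hc := hpos s(a, b) hab
  rcases (forestPot_nonneg hpos F hab a).eq_or_lt with h | h
  · rw [← h, mul_zero]
    exact mul_nonneg (treeSum_nonneg hpos F) (mul_pos hc hR).le
  · have h1 := effCond_le_div hpos F hab h
    rw [le_div_iff₀ h] at h1
    have h2 : forestPot G c F a b a ≤ treeSum G c F * effRes G c a b := by
      rw [effRes, ← div_eq_mul_inv, le_div_iff₀ (effCond_pos hpos hconn hab)]
      linarith
    calc c s(a, b) * forestPot G c F a b a ≤ c s(a, b) * (treeSum G c F * effRes G c a b) :=
          mul_le_mul_of_nonneg_left h2 hc.le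
      _ = _ := by ring

open scoped Classical in
theorem card_darts_spanningTree {G : SimpleGraph V} {T : Finset (Sym2 V)}
    (hT : T ∈ spanningTrees G) :
    ∑ v : V, ∑ u : V, (if s(v, u) ∈ T then (1 : ℝ) else 0) ≤ 2 * Fintype.card V := by
  have h1 : ∀ v, ∑ u : V, (if s(v, u) ∈ T then (1 : ℝ) else 0) = ((edgeGraph T).degree v : ℝ) := by
    intro v
    rw [Finset.sum_boole, ← SimpleGraph.card_neighborFinset_eq_degree]
    congr 2
    ext u
    simp only [Finset.mem_filter, Finset.mem_univ, true_and, SimpleGraph.mem_neighborFinset,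
      SimpleGraph.fromEdgeSet_adj, Finset.mem_coe]
    exact ⟨fun h => ⟨h, (adj_of_mem_spanningTrees hT h).ne⟩, fun h => h.1⟩
  rw [Finset.sum_congr rfl fun v _ => h1 v]
  have h2 := (edgeGraph T).sum_degrees_eq_twice_card_edges
  have h4 : ∑ v, (edgeGraph T).degree v ≤ 2 * Fintype.card V := by
    rw [h2]
    refine Nat.mul_le_mul_left 2 ((Nat.le_add_right _ 1).trans (le_of_eq ?_))
    convert (mem_spanningTrees.1 hT).2.card_edgeFinset
  exact_mod_cast h4

/-- Foster's inequality. -/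
theorem sum_mul_effRes_le {G : SimpleGraph V} [DecidableRel G.Adj] {c : Sym2 V → ℝ}
    (hpos : ∀ e ∈ G.edgeSet, 0 < c e) (hconn : G.Connected) :
    ∑ v : V, ∑ u ∈ G.neighborFinset v, c s(v, u) * effRes G c v u ≤ 2 * Fintype.card V := by
  have hZ := partZ_pos hpos hconn
  have h1 : ∀ v, ∑ u ∈ G.neighborFinset v, c s(v, u) * effRes G c v u ≤
      (∑ T ∈ spanningTrees G, ∑ u : V, if s(v, u) ∈ T then treeWeight c T else 0) / partZ G c := by
    intro v
    rw [Finset.sum_comm, Finset.sum_div]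
    refine (Finset.sum_le_sum fun u hu => ?_).trans
      (Finset.sum_le_sum_of_subset_of_nonneg (Finset.subset_univ (G.neighborFinset v)) ?_)
    · rw [mul_effRes_eq hpos hconn ((G.mem_neighborFinset v u).1 hu), treeSum]
      simp only [Finset.singleton_subset_iff]
      exact le_rfl
    · intro u _ _
      refine div_nonneg (Finset.sum_nonneg fun T hT => ?_) hZ.le
      split_ifs
      · exact (treeWeight_pos hpos (mem_spanningTrees.1 hT).1).le
      · exact le_rfl
  refine (Finset.sum_le_sum fun v _ => h1 v).trans ?_
  rw [← Finset.sum_div, div_le_iff₀ hZ, Finset.sum_comm, partZ, Finset.mul_sum]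
  refine Finset.sum_le_sum fun T hT => ?_
  have h2 := card_darts_spanningTree hT
  have hw := treeWeight_pos hpos (mem_spanningTrees.1 hT).1
  calc ∑ v : V, ∑ u : V, (if s(v, u) ∈ T then treeWeight c T else 0)
      = (∑ v : V, ∑ u : V, (if s(v, u) ∈ T then (1 : ℝ) else 0)) * treeWeight c T := by
        simp_rw [Finset.sum_mul, ite_mul, one_mul, zero_mul]
    _ ≤ _ := by
        refine mul_le_mul_of_nonneg_right ?_ hw.le
        convert h2

/-- The conductance matrix of the network `(G, c)`. -/
def condMatrix (G : SimpleGraph V) [DecidableRel G.Adj] (c : Sym2 V → ℝ) (x y : V) : ℝ :=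
  if G.Adj x y then c s(x, y) else 0

theorem condMatrix_symm (G : SimpleGraph V) [DecidableRel G.Adj] (c : Sym2 V → ℝ) (x y : V) :
    condMatrix G c x y = condMatrix G c y x := by
  simp [condMatrix, G.adj_comm x y, Sym2.eq_swap (a := x) (b := y)]

theorem condMatrix_nonneg {G : SimpleGraph V} [DecidableRel G.Adj] {c : Sym2 V → ℝ}
    (hpos : ∀ e ∈ G.edgeSet, 0 < c e) (x y : V) : 0 ≤ condMatrix G c x y := by
  unfold condMatrix
  split_ifs with h
  · exact (hpos _ h).le
  · exact le_rfl

theorem sum_neighborFinset (G : SimpleGraph V) [DecidableRel G.Adj] (c : Sym2 V → ℝ)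
    (f : V → ℝ) (v : V) :
    ∑ u ∈ G.neighborFinset v, c s(u, v) * f u = ∑ u, condMatrix G c v u * f u := by
  rw [SimpleGraph.neighborFinset_eq_filter, Finset.sum_filter]
  refine Finset.sum_congr rfl fun u _ => ?_
  rw [condMatrix, Sym2.eq_swap]
  split_ifs <;> simp

theorem vertCond_eq_sum (G : SimpleGraph V) [DecidableRel G.Adj] (c : Sym2 V → ℝ) (v : V) :
    vertCond G c v = ∑ u, condMatrix G c v u := by
  simpa [vertCond] using sum_neighborFinset G c (fun _ => 1) v

theorem vertCond_eq_sum' (G : SimpleGraph V) [DecidableRel G.Adj] (c : Sym2 V → ℝ) (v : V) :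
    vertCond G c v = ∑ u, condMatrix G c u v := by
  simp_rw [vertCond_eq_sum, condMatrix_symm G c v]

theorem energy_eq_sum (G : SimpleGraph V) [DecidableRel G.Adj] (c : Sym2 V → ℝ) (h : V → ℝ) :
    energy G c h = (1 / 2) * ∑ x, ∑ y, condMatrix G c x y * (h y - h x) ^ 2 := by
  unfold energy
  simp_rw [fun v => sum_neighborFinset G c (fun u => (h u - h v) ^ 2) v]

theorem effCond_le_add {G : SimpleGraph V} [DecidableRel G.Adj] {c : Sym2 V → ℝ}
    (hpos : ∀ e ∈ G.edgeSet, 0 < c e) {u v : V} (huv : G.Adj u v) (t : ℝ) :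
    effCond G c u v ≤ c s(u, v) + vertCond G c u * (1 - t) ^ 2 + vertCond G c v * t ^ 2 := by
  set h : V → ℝ := fun x => if x = u then 1 else if x = v then 0 else t with hdef
  refine (effCond_le_energy hpos h (by simp [hdef]) (by simp [hdef, huv.ne'])).trans ?_
  rw [energy_eq_sum]
  have key : ∀ x y, condMatrix G c x y * (h y - h x) ^ 2 ≤
      (if x = u then if y = v then condMatrix G c x y else 0 else 0) +
      (if x = v then if y = u then condMatrix G c x y else 0 else 0) +
      (if x = u then condMatrix G c x y * (1 - t) ^ 2 else 0) +
      (if y = u then condMatrix G c x y * (1 - t) ^ 2 else 0) +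
      (if x = v then condMatrix G c x y * t ^ 2 else 0) +
      (if y = v then condMatrix G c x y * t ^ 2 else 0) := by
    intro x y
    have hw := condMatrix_nonneg hpos x y
    have h1 : 0 ≤ condMatrix G c x y * (1 - t) ^ 2 := mul_nonneg hw (sq_nonneg _)
    have h2 : 0 ≤ condMatrix G c x y * t ^ 2 := mul_nonneg hw (sq_nonneg _)
    have hvu := huv.ne'
    by_cases hxu : x = u <;> by_cases hyu : y = u <;> by_cases hxv : x = v <;>
      by_cases hyv : y = v <;> simp_all <;> nlinarith
  have hsum := Finset.sum_le_sum fun x (_ : x ∈ Finset.univ) =>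
    Finset.sum_le_sum fun y (_ : y ∈ Finset.univ) => key x y
  simp only [Finset.sum_add_distrib] at hsum
  have e1 : ∑ x, ∑ y, (if x = u then if y = v then condMatrix G c x y else 0 else 0) =
      c s(u, v) := by
    rw [Finset.sum_eq_single u (by intro b _ hb; simp [hb]) (by simp)]
    simp [condMatrix, huv]
  have e2 : ∑ x, ∑ y, (if x = v then if y = u then condMatrix G c x y else 0 else 0) =
      c s(u, v) := by
    rw [Finset.sum_eq_single v (by intro b _ hb; simp [hb]) (by simp)]
    simp [condMatrix, huv.symm, Sym2.eq_swap]
  have e3 : ∀ (z : V) (s : ℝ), ∑ x, ∑ y, (if x = z then condMatrix G c x y * s else 0) =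
      vertCond G c z * s := by
    intro z s
    rw [Finset.sum_eq_single z (by intro b _ hb; simp [hb]) (by simp), vertCond_eq_sum,
      Finset.sum_mul]
    simp
  have e4 : ∀ (z : V) (s : ℝ), ∑ x, ∑ y, (if y = z then condMatrix G c x y * s else 0) =
      vertCond G c z * s := by
    intro z s
    rw [vertCond_eq_sum', Finset.sum_mul]
    simp
  rw [e1, e2, e3, e3, e4, e4] at hsum
  linarith

theorem sub_le_inv_of_le_add {w q x : ℝ} (hw : 0 ≤ w) (hq : 0 < q) (hx : 0 < x)
    (hxq : x ≤ w + q) : q⁻¹ - w * (q⁻¹) ^ 2 ≤ x⁻¹ := by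
  have h1 : (w + q)⁻¹ ≤ x⁻¹ := inv_anti₀ hx hxq
  have h2 : q⁻¹ - w * (q⁻¹) ^ 2 ≤ (w + q)⁻¹ := by
    have : q⁻¹ - w * (q⁻¹) ^ 2 = (q - w) / q ^ 2 := by field_simp
    rw [this, ← one_div, div_le_div_iff₀ (by positivity) (by positivity)]
    nlinarith [sq_nonneg w]
  exact h2.trans h1

theorem le_mul_effRes {G : SimpleGraph V} [DecidableRel G.Adj] {c : Sym2 V → ℝ}
    (hpos : ∀ e ∈ G.edgeSet, 0 < c e) (hconn : G.Connected) (hC : ∀ v, 0 < vertCond G c v)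
    (u v : V) :
    condMatrix G c u v / vertCond G c u + condMatrix G c u v / vertCond G c v -
      2 * (condMatrix G c u v / vertCond G c u) ^ 2 -
      2 * (condMatrix G c u v / vertCond G c v) ^ 2 ≤ condMatrix G c u v * effRes G c u v := by
  by_cases huv : G.Adj u v
  swap
  · simp [condMatrix, huv]
  have hw : condMatrix G c u v = c s(u, v) := by simp [condMatrix, huv]
  have hw0 := condMatrix_nonneg hpos u v
  have hE := effCond_le_add hpos huv (vertCond G c u / (vertCond G c u + vertCond G c v))
  rw [← hw] at hE
  rw [effRes]
  have hA := hC u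
  have hB := hC v
  generalize vertCond G c u = A at *
  generalize vertCond G c v = B at *
  generalize condMatrix G c u v = w at *
  have hq : A * (1 - A / (A + B)) ^ 2 + B * (A / (A + B)) ^ 2 = A * B / (A + B) := by
    field_simp; ring
  have h1 := sub_le_inv_of_le_add hw0 (show 0 < A * B / (A + B) by positivity)
    (effCond_pos hpos hconn huv) (by linarith)
  have hqi : (A * B / (A + B))⁻¹ = A⁻¹ + B⁻¹ := by field_simp; ring
  rw [hqi] at h1
  refine le_trans ?_ (mul_le_mul_of_nonneg_left h1 hw0)
  simp only [div_eq_mul_inv]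
  have : 0 ≤ w ^ 2 * (A⁻¹ - B⁻¹) ^ 2 := by positivity
  nlinarith

open scoped Classical in
theorem sum_bad_le (w R : V → V → ℝ) (C : V → ℝ) (typ : V → Prop) {γ δ : ℝ} (hγ : 0 < γ)
    (hδ : 0 ≤ δ) (hw : ∀ u v, 0 ≤ w u v) (hsymm : ∀ u v, w u v = w v u)
    (hC : ∀ v, C v = ∑ u, w v u) (hCpos : ∀ v, 0 < C v) (htyp : ∀ v, typ v → γ ≤ C v)
    (hwδ : ∀ u v, w u v ≤ δ * γ)
    (hlow : ∀ u v, w u v / C u + w u v / C v - 2 * (w u v / C u) ^ 2 - 2 * (w u v / C v) ^ 2 ≤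
      w u v * R u v)
    (hsum : ∑ u, ∑ v, w u v * R u v ≤ 2 * Fintype.card V)
    (hN : ((Finset.univ.filter fun v => ¬ typ v).card : ℝ) ≤ δ * Fintype.card V) :
    ∑ u, ∑ v, (if R u v ≤ 4 / γ then 0 else w u v * R u v) ≤ 20 * (δ * Fintype.card V) := by
  set D : V → V → ℝ := fun u v => w u v * R u v - w u v / C u - w u v / C v +
    2 * (w u v / C u) ^ 2 + 2 * (w u v / C v) ^ 2 with hD
  have hD0 : ∀ u v, 0 ≤ D u v := fun u v => by
    have := hlow u v
    simp only [hD]; linarith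
  have hrow : ∀ u, ∑ v, w u v / C u = 1 := fun u => by
    rw [← Finset.sum_div, ← hC, div_self (hCpos u).ne']
  have hsq : ∀ u, ∑ v, (w u v / C u) ^ 2 ≤ δ + if typ u then 0 else 1 := by
    intro u
    by_cases hu : typ u
    · rw [if_pos hu, add_zero, ← mul_one δ, ← hrow u, Finset.mul_sum]
      refine Finset.sum_le_sum fun v _ => ?_
      rw [sq]
      refine mul_le_mul_of_nonneg_right ?_ (div_nonneg (hw u v) (hCpos u).le)
      rw [div_le_iff₀ (hCpos u)]
      exact (hwδ u v).trans (mul_le_mul_of_nonneg_left (htyp u hu) hδ)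
    · rw [if_neg hu]
      refine le_trans ?_ (le_add_of_nonneg_left hδ)
      rw [← hrow u]
      refine Finset.sum_le_sum fun v _ => ?_
      have h0 := div_nonneg (hw u v) (hCpos u).le
      have h1 : w u v / C u ≤ 1 := by
        rw [div_le_one (hCpos u), hC]
        exact Finset.single_le_sum (f := fun v => w u v) (fun v _ => hw u v) (Finset.mem_univ v)
      nlinarith
  have hcard : ∑ u, (if typ u then (0 : ℝ) else 1) ≤ δ * Fintype.card V := by
    refine le_trans (le_of_eq ?_) hN
    rw [Finset.card_filter]
    push_cast
    exact Finset.sum_congr rfl fun u _ => by by_cases h : typ u <;> simp [h]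
  have hsqsum : ∑ u, ∑ v, (w u v / C u) ^ 2 ≤ 2 * (δ * Fintype.card V) := by
    refine (Finset.sum_le_sum fun u _ => hsq u).trans ?_
    rw [Finset.sum_add_distrib]
    simp only [Finset.sum_const, Finset.card_univ, nsmul_eq_mul]
    linarith
  have hsqsum' : ∑ u, ∑ v, (w u v / C v) ^ 2 ≤ 2 * (δ * Fintype.card V) := by
    rw [Finset.sum_comm]
    simpa only [hsymm] using hsqsum
  have hone : ∑ u, ∑ v, w u v / C u = Fintype.card V := by simp [hrow]
  have hone' : ∑ u, ∑ v, w u v / C v = Fintype.card V := by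
    rw [Finset.sum_comm, ← hone]
    exact Finset.sum_congr rfl fun u _ => Finset.sum_congr rfl fun v _ => by rw [hsymm]
  have hDsum : ∑ u, ∑ v, D u v ≤ 8 * (δ * Fintype.card V) := by
    simp only [hD, Finset.sum_add_distrib, Finset.sum_sub_distrib, ← Finset.mul_sum]
    linarith
  have hA : ∑ u, ∑ v, (if typ u then 0 else w u v / C u) ≤ δ * Fintype.card V := by
    refine le_trans (le_of_eq ?_) hcard
    refine Finset.sum_congr rfl fun u _ => ?_
    split_ifs
    · simp
    · exact hrow u
  have hA' : ∑ u, ∑ v, (if typ v then 0 else w u v / C v) ≤ δ * Fintype.card V := by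
    rw [Finset.sum_comm]
    refine le_trans (le_of_eq ?_) hA
    exact Finset.sum_congr rfl fun u _ => Finset.sum_congr rfl fun v _ => by rw [hsymm]
  have key : ∀ u v, (if R u v ≤ 4 / γ then 0 else w u v * R u v) ≤
      2 * (D u v + (if typ u then 0 else w u v / C u) + (if typ v then 0 else w u v / C v)) := by
    intro u v
    have hu0 := div_nonneg (hw u v) (hCpos u).le
    have hv0 := div_nonneg (hw u v) (hCpos v).le
    have h0 := hD0 u v
    by_cases hR : R u v ≤ 4 / γ
    · rw [if_pos hR]
      split_ifs <;> linarith
    · rw [if_neg hR]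
      have hR' : w u v / γ ≤ w u v * R u v / 4 := by
        have h4 : w u v * (4 / γ) ≤ w u v * R u v :=
          mul_le_mul_of_nonneg_left (not_le.1 hR).le (hw u v)
        have : w u v * (4 / γ) = 4 * (w u v / γ) := by ring
        linarith
      have hdiv : ∀ z, typ z → w u v / C z ≤ w u v / γ := fun z hz =>
        div_le_div_of_nonneg_left (hw u v) hγ (htyp z hz)
      have hp : w u v * R u v ≤ D u v + w u v / C u + w u v / C v := by
        simp only [hD]
        nlinarith [sq_nonneg (w u v / C u), sq_nonneg (w u v / C v)]
      have hwR : 0 ≤ w u v * R u v := by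
        linarith [div_nonneg (hw u v) hγ.le]
      split_ifs with hu hv hv
      · linarith [hdiv u hu, hdiv v hv]
      · linarith [hdiv u hu]
      · linarith [hdiv v hv]
      · linarith
  refine (Finset.sum_le_sum fun u _ => Finset.sum_le_sum fun v _ => key u v).trans ?_
  simp only [← Finset.mul_sum, Finset.sum_add_distrib]
  linarith

open scoped Classical in
/-- The conditions of Assumption (LL) on a single network, with parameters `γ`, `K`, `δ`. -/
structure LocalLimitNetwork (G : SimpleGraph V) [DecidableRel G.Adj] (c : Sym2 V → ℝ)
    (γ K δ : ℝ) : Prop where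
  connected : G.Connected
  pos : ∀ e ∈ G.edgeSet, 0 < c e
  one_lt : 1 < K
  γ_pos : 0 < γ
  δ_pos : 0 < δ
  δ_le_one : δ ≤ 1
  card_le : ((Finset.univ.filter fun v => ¬ typCond G c γ K v).card : ℝ) ≤ δ * Fintype.card V
  sum_le : ∑ v ∈ Finset.univ.filter (fun v => ¬ typCond G c γ K v), vertCond G c v ≤
    δ * γ * Fintype.card V
  edge_le : ∀ e ∈ G.edgeSet, c e ≤ δ * γ
  vertCond_pos : ∀ v, 0 < vertCond G c v

namespace LocalLimitNetwork

variable {G : SimpleGraph V} [DecidableRel G.Adj] {c : Sym2 V → ℝ} {γ K δ : ℝ}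

open scoped Classical in
theorem sum_bad_le (h : LocalLimitNetwork G c γ K δ) :
    ∑ u, ∑ v, (if effRes G c u v ≤ 4 / γ then 0 else condMatrix G c u v * effRes G c u v) ≤
      20 * (δ * Fintype.card V) := by
  refine WSTPaper.sum_bad_le (condMatrix G c) (effRes G c) (vertCond G c) (typCond G c γ K)
    h.γ_pos h.δ_pos.le (condMatrix_nonneg h.pos) (condMatrix_symm G c) (vertCond_eq_sum G c)
    h.vertCond_pos (fun v hv => hv.1) ?_ (le_mul_effRes h.pos h.connected h.vertCond_pos) ?_
    h.card_le
  · intro u v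
    unfold condMatrix
    split_ifs with huv
    · exact h.edge_le _ huv
    · exact (mul_pos h.δ_pos h.γ_pos).le
  · refine le_trans (le_of_eq ?_) (sum_mul_effRes_le h.pos h.connected)
    refine Finset.sum_congr rfl fun v _ => ?_
    rw [← sum_neighborFinset G c (fun u => effRes G c v u) v]
    exact Finset.sum_congr rfl fun u _ => by rw [Sym2.eq_swap]

open scoped Classical in
theorem card_not_typNbrs (h : LocalLimitNetwork G c γ K δ) :
    ((Finset.univ.filter fun v => ¬ typNbrs G c γ K δ v).card : ℝ) ≤
      21 * (Real.sqrt δ * Fintype.card V) := by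
  have hs : 0 < Real.sqrt δ := Real.sqrt_pos.2 h.δ_pos
  have hss : Real.sqrt δ * Real.sqrt δ = δ := Real.mul_self_sqrt h.δ_pos.le
  set f : V → ℝ := fun v => ∑ u, (if effRes G c v u ≤ 4 / γ then 0 else
    condMatrix G c v u * effRes G c v u) with hf
  set g : V → ℝ := fun v => ∑ u, (if typCond G c γ K u then 0 else condMatrix G c v u / γ) with hg
  have hR : ∀ u v, 0 ≤ condMatrix G c v u * effRes G c v u := fun u v => by
    by_cases huv : G.Adj v u
    · exact mul_nonneg (condMatrix_nonneg h.pos v u) (effRes_pos h.pos h.connected huv).le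
    · simp [condMatrix, huv]
  have hf0 : ∀ v, 0 ≤ f v := fun v => Finset.sum_nonneg fun u _ => by
    split_ifs
    · exact le_rfl
    · exact hR u v
  have hg0 : ∀ v, 0 ≤ g v := fun v => Finset.sum_nonneg fun u _ => by
    split_ifs
    · exact le_rfl
    · exact div_nonneg (condMatrix_nonneg h.pos v u) h.γ_pos.le
  have hmark : ∀ v, ¬ typNbrs G c γ K δ v → Real.sqrt δ ≤ f v + g v := by
    intro v hv
    refine (not_le.1 hv).le.trans (le_of_eq ?_)
    congr 1
    · rw [hf]
      simp only
      rw [SimpleGraph.neighborFinset_eq_filter, Finset.sum_filter]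
      refine Finset.sum_congr rfl fun u _ => ?_
      by_cases huv : G.Adj v u
      · simp [condMatrix, huv, effRes_symm h.pos h.connected huv, Sym2.eq_swap (a := u) (b := v)]
      · simp [condMatrix, huv]
    · rw [hg]
      simp only
      rw [SimpleGraph.neighborFinset_eq_filter, Finset.filter_filter, Finset.sum_filter]
      refine Finset.sum_congr rfl fun u _ => ?_
      by_cases huv : G.Adj v u <;> by_cases hu : typCond G c γ K u <;>
        simp [condMatrix, huv, hu, Sym2.eq_swap (a := u) (b := v)]
  have hgsum : ∑ v, g v ≤ δ * Fintype.card V := by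
    rw [hg]
    simp only
    rw [Finset.sum_comm]
    have h1 := h.sum_le
    rw [Finset.sum_filter] at h1
    have h2 : ∀ u, ∑ v, (if typCond G c γ K u then 0 else condMatrix G c v u / γ) =
        (if ¬ typCond G c γ K u then vertCond G c u else 0) / γ := by
      intro u
      by_cases hu : typCond G c γ K u
      · simp [hu]
      · simp [hu, vertCond_eq_sum', Finset.sum_div]
    rw [Finset.sum_congr rfl fun u _ => h2 u, ← Finset.sum_div, div_le_iff₀ h.γ_pos]
    refine le_trans h1 (le_of_eq (by ring))
  have h3 : Real.sqrt δ * ((Finset.univ.filter fun v => ¬ typNbrs G c γ K δ v).card : ℝ) ≤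
      ∑ v, (f v + g v) := by
    rw [mul_comm, ← nsmul_eq_mul, ← Finset.sum_const]
    refine (Finset.sum_le_sum fun v hv => hmark v (Finset.mem_filter.1 hv).2).trans ?_
    exact Finset.sum_le_sum_of_subset_of_nonneg (Finset.filter_subset _ _)
      fun v _ _ => add_nonneg (hf0 v) (hg0 v)
  rw [Finset.sum_add_distrib] at h3
  have h4 := h.sum_bad_le
  have h5 : Real.sqrt δ * ((Finset.univ.filter fun v => ¬ typNbrs G c γ K δ v).card : ℝ) ≤
      Real.sqrt δ * (21 * (Real.sqrt δ * Fintype.card V)) := by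
    have : Real.sqrt δ * (21 * (Real.sqrt δ * Fintype.card V)) =
      21 * ((Real.sqrt δ * Real.sqrt δ) * Fintype.card V) := by ring
    rw [this, hss]
    linarith
  exact le_of_mul_le_mul_left h5 hs

theorem le_sqrt (h : LocalLimitNetwork G c γ K δ) : δ ≤ Real.sqrt δ :=
  Real.le_sqrt_of_sq_le (by nlinarith [h.δ_pos, h.δ_le_one])

open scoped Classical in
theorem card_not_goodVert (h : LocalLimitNetwork G c γ K δ) :
    ((Finset.univ.filter fun v => ¬ goodVert G c γ K δ v).card : ℝ) ≤
      22 * (Real.sqrt δ * Fintype.card V) := by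
  have h1 : (Finset.univ.filter fun v => ¬ goodVert G c γ K δ v) ⊆
      (Finset.univ.filter fun v => ¬ typCond G c γ K v) ∪
        (Finset.univ.filter fun v => ¬ typNbrs G c γ K δ v) := by
    intro v hv
    have hv' := (Finset.mem_filter.1 hv).2
    simp only [Finset.mem_union, Finset.mem_filter, Finset.mem_univ, true_and]
    by_contra hcon
    rw [not_or, not_not, not_not] at hcon
    exact hv' hcon
  have h2 : ((Finset.univ.filter fun v => ¬ goodVert G c γ K δ v).card : ℝ) ≤
      ((Finset.univ.filter fun v => ¬ typCond G c γ K v).card : ℝ) +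
        ((Finset.univ.filter fun v => ¬ typNbrs G c γ K δ v).card : ℝ) := by
    exact_mod_cast (Finset.card_le_card h1).trans (Finset.card_union_le _ _)
  have h3 := h.card_not_typNbrs
  have h4 := h.card_le
  have h5 : δ * Fintype.card V ≤ Real.sqrt δ * Fintype.card V :=
    mul_le_mul_of_nonneg_right h.le_sqrt (Nat.cast_nonneg _)
  linarith

open scoped Classical in
theorem sum_not_goodVert (h : LocalLimitNetwork G c γ K δ) :
    ∑ v, (if goodVert G c γ K δ v then 0 else 1 + 4 * vertCond G c v / γ) ≤
      (26 + 88 * K) * (Real.sqrt δ * Fintype.card V) := by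
  have hK := h.one_lt
  have key : ∀ v, (if goodVert G c γ K δ v then 0 else 1 + 4 * vertCond G c v / γ) ≤
      (1 + 4 * K) * (if ¬ goodVert G c γ K δ v then 1 else 0) +
      4 * ((if ¬ typCond G c γ K v then vertCond G c v else 0) / γ) := by
    intro v
    have hv : 0 < vertCond G c v / γ := div_pos (h.vertCond_pos v) h.γ_pos
    have e : 4 * vertCond G c v / γ = 4 * (vertCond G c v / γ) := by ring
    rw [e]
    by_cases hg : goodVert G c γ K δ v
    · have ht := hg.1
      simp [hg, ht]
    · by_cases ht : typCond G c γ K v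
      · have : vertCond G c v / γ ≤ K := by
          rw [div_le_iff₀ h.γ_pos]; exact ht.2
        simp [hg, ht]
        linarith
      · simp [hg, ht]
        linarith
  refine (Finset.sum_le_sum fun v _ => key v).trans ?_
  rw [Finset.sum_add_distrib, ← Finset.mul_sum, ← Finset.mul_sum, Finset.sum_boole,
    ← Finset.sum_div, ← Finset.sum_filter]
  have h1 := h.card_not_goodVert
  have h2 : (∑ v ∈ Finset.univ.filter (fun v => ¬ typCond G c γ K v), vertCond G c v) / γ ≤
      δ * Fintype.card V := by
    rw [div_le_iff₀ h.γ_pos]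
    exact h.sum_le.trans (le_of_eq (by ring))
  have h5 : δ * Fintype.card V ≤ Real.sqrt δ * Fintype.card V :=
    mul_le_mul_of_nonneg_right h.le_sqrt (Nat.cast_nonneg _)
  have h6 := mul_le_mul_of_nonneg_left h1 (show 0 ≤ 1 + 4 * K by linarith)
  nlinarith

end LocalLimitNetwork

/-- A step along an edge of small effective resistance into a vertex of `W̃ₙ`. -/
def goodStep (G : SimpleGraph V) [DecidableRel G.Adj] (c : Sym2 V → ℝ) (γ K δ : ℝ) (y u : V) :
    Prop := G.Adj y u ∧ effRes G c y u ≤ 4 / γ ∧ goodVert G c γ K δ u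

/-- There is a trail of length `k` from `y` to `x` with edges in `T \ F` and steps in `step`. -/
def HasChain (step : V → V → Prop) (T : Finset (Sym2 V)) : ℕ → Finset (Sym2 V) → V → V → Prop
  | 0, _, y, x => y = x
  | k + 1, F, y, x =>
    ∃ u, step y u ∧ s(y, u) ∈ T ∧ s(y, u) ∉ F ∧ HasChain step T k (insert s(y, u) F) u x

open scoped Classical in
/-- The total weight of pairs `(x, T)` with `F ⊆ T` and a chain of length `k` in `T` from `y`
to `x`. -/
def chainSum (G : SimpleGraph V) (c : Sym2 V → ℝ) (step : V → V → Prop) (k : ℕ)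
    (F : Finset (Sym2 V)) (y : V) : ℝ :=
  ∑ x, ∑ T ∈ spanningTrees G, if F ⊆ T ∧ HasChain step T k F y x then treeWeight c T else 0

theorem chainSum_zero (G : SimpleGraph V) (c : Sym2 V → ℝ) (step : V → V → Prop)
    (F : Finset (Sym2 V)) (y : V) : chainSum G c step 0 F y = treeSum G c F := by
  classical
  rw [chainSum, Finset.sum_eq_single y]
  · simp [HasChain, treeSum]
  · intro x _ hx
    simp [HasChain, hx.symm]
  · simp

theorem treeWeight_nonneg {G : SimpleGraph V} {c : Sym2 V → ℝ}
    (hpos : ∀ e ∈ G.edgeSet, 0 < c e) {T : Finset (Sym2 V)} (hT : T ∈ spanningTrees G) :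
    0 ≤ treeWeight c T :=
  (treeWeight_pos hpos (mem_spanningTrees.1 hT).1).le

open scoped Classical in
theorem chainSum_succ_le {G : SimpleGraph V} {c : Sym2 V → ℝ}
    (hpos : ∀ e ∈ G.edgeSet, 0 < c e) (step : V → V → Prop) (k : ℕ)
    (F : Finset (Sym2 V)) (y : V) :
    chainSum G c step (k + 1) F y ≤
      ∑ u, if step y u ∧ s(y, u) ∉ F then chainSum G c step k (insert s(y, u) F) u else 0 := by
  have e : ∀ u, (if step y u ∧ s(y, u) ∉ F then chainSum G c step k (insert s(y, u) F) u else 0) =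
      ∑ x, ∑ T ∈ spanningTrees G, if (step y u ∧ s(y, u) ∉ F) ∧ insert s(y, u) F ⊆ T ∧
        HasChain step T k (insert s(y, u) F) u x then treeWeight c T else 0 := by
    intro u
    by_cases h : step y u ∧ s(y, u) ∉ F
    · rw [if_pos h, chainSum]
      refine Finset.sum_congr rfl fun x _ => Finset.sum_congr rfl fun T _ => ?_
      simp only [h, true_and, not_false_eq_true]
    · rw [if_neg h]
      symm
      refine Finset.sum_eq_zero fun x _ => Finset.sum_eq_zero fun T _ => ?_
      rw [if_neg fun h' => h h'.1]
  rw [Finset.sum_congr rfl fun u _ => e u, Finset.sum_comm, chainSum]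
  refine Finset.sum_le_sum fun x _ => ?_
  rw [Finset.sum_comm]
  refine Finset.sum_le_sum fun T hT => ?_
  have hw := treeWeight_nonneg hpos hT
  have hnn : ∀ u ∈ Finset.univ, 0 ≤ (if (step y u ∧ s(y, u) ∉ F) ∧ insert s(y, u) F ⊆ T ∧
        HasChain step T k (insert s(y, u) F) u x then treeWeight c T else 0) := fun u _ => by
    split_ifs
    · exact hw
    · exact le_rfl
  split_ifs with h
  · obtain ⟨hF, u, h1, h2, h3, h4⟩ := h
    refine le_trans (le_of_eq ?_) (Finset.single_le_sum hnn (Finset.mem_univ u))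
    rw [if_pos ⟨⟨h1, h3⟩, Finset.insert_subset h2 hF, h4⟩]
  · exact Finset.sum_nonneg hnn

theorem hasChain_of_walk {step : V → V → Prop} {T F : Finset (Sym2 V)} {y x : V}
    (p : (edgeGraph T).Walk y x) (hp : p.IsTrail) (hF : ∀ e ∈ p.edges, e ∉ F)
    (hstep : ∀ u v, s(u, v) ∈ T → v ∈ p.support.tail → step u v) :
    HasChain step T p.length F y x := by
  induction p generalizing F with
  | nil => rfl
  | @cons y u x h q ih =>
    rw [SimpleGraph.Walk.isTrail_cons] at hp
    have hT : s(y, u) ∈ T := by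
      rw [SimpleGraph.fromEdgeSet_adj] at h
      exact h.1
    rw [SimpleGraph.Walk.length_cons]
    refine ⟨u, hstep y u hT (by simp), hT, hF _ (by simp), ih hp.1 ?_ ?_⟩
    · intro e he
      rw [Finset.mem_insert, not_or]
      refine ⟨?_, hF e (by simp [he])⟩
      rintro rfl
      exact hp.2 he
    · intro a b hab hb
      exact hstep a b hab (by simpa using List.mem_of_mem_tail hb)

theorem exists_minimal_walk (H : SimpleGraph V) (M : V → Prop) {x y : V} {r : ℕ} (hy : M y)
    (h : H.Reachable x y) (hr : H.dist x y ≤ r) :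
    ∃ z, M z ∧ ∃ p : H.Walk z x, p.IsPath ∧ p.length ≤ r ∧ ∀ v ∈ p.support.tail, ¬ M v := by
  classical
  have hex : ∃ n, ∃ z, M z ∧ ∃ p : H.Walk z x, p.length = n := by
    obtain ⟨p⟩ := h
    exact ⟨_, y, hy, p.reverse, rfl⟩
  obtain ⟨z, hz, p, hp⟩ := Nat.find_spec hex
  have hmin : ∀ v (_ : M v) (q : H.Walk v x), p.length ≤ q.length := fun v hv q => by
    rw [hp]
    exact Nat.find_min' hex ⟨v, hv, q, rfl⟩
  have hbl := p.length_bypass_le_length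
  refine ⟨z, hz, p.bypass, p.bypass_isPath, ?_, ?_⟩
  · obtain ⟨q, hq⟩ := h.symm.exists_walk_length_eq_dist
    rw [SimpleGraph.dist_comm] at hq
    exact hbl.trans ((hmin y hy q).trans (hq.le.trans hr))
  · intro v hv hM
    generalize p.bypass = q at hv hbl
    cases q with
    | nil => simp at hv
    | cons h q =>
      rw [SimpleGraph.Walk.support_cons, List.tail_cons] at hv
      have h1 := hmin v hM (q.dropUntil v hv)
      have h2 := q.length_dropUntil_le_length hv
      rw [SimpleGraph.Walk.length_cons] at hbl
      omega

theorem exists_hasChain_of_not_niceBall {G : SimpleGraph V} [DecidableRel G.Adj]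
    {c : Sym2 V → ℝ} (hpos : ∀ e ∈ G.edgeSet, 0 < c e) (hconn : G.Connected) {γ K δ : ℝ}
    {T : Finset (Sym2 V)} (hT : T ∈ spanningTrees G) {x : V} {r : ℕ}
    (h : ¬ NiceBall G c γ K δ T x r) :
    ∃ k < r + 1, ∃ y,
      (¬ goodVert G c γ K δ y ∧ HasChain (goodStep G c γ K δ) T k ∅ y x) ∨
      (goodVert G c γ K δ y ∧ ∃ z, G.Adj y z ∧ ¬ effRes G c y z ≤ 4 / γ ∧ s(y, z) ∈ T ∧
        HasChain (goodStep G c γ K δ) T k {s(y, z)} y x) := by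
  set M : V → Prop := fun y => ¬ goodVert G c γ K δ y ∨
    ∃ z, s(y, z) ∈ T ∧ ¬ effRes G c y z ≤ 4 / γ with hM
  have hadj : ∀ {a b}, s(a, b) ∈ T → G.Adj a b := fun hab => adj_of_mem_spanningTrees hT hab
  have hex : ∃ y, M y ∧ (edgeGraph T).Reachable x y ∧ (edgeGraph T).dist x y ≤ r := by
    by_contra hcon
    push Not at hcon
    refine h ⟨fun y hy => ?_, fun y hy z _ hyz => ?_⟩
    · by_contra hg
      exact absurd hy.2 (not_le.2 (hcon y (Or.inl hg) hy.1))
    · by_contra hg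
      rw [SimpleGraph.fromEdgeSet_adj] at hyz
      exact absurd hy.2 (not_le.2 (hcon y (Or.inr ⟨z, hyz.1, hg⟩) hy.1))
  obtain ⟨y₀, hy₀, hreach, hdist⟩ := hex
  obtain ⟨y, hy, p, hpath, hlen, htail⟩ := exists_minimal_walk _ M hy₀ hreach hdist
  have hstep : ∀ u v, s(u, v) ∈ T → v ∈ p.support.tail → goodStep G c γ K δ u v := by
    intro u v huv hv
    have hMv := htail v hv
    rw [hM] at hMv
    simp only [not_or, not_not, not_exists, not_and] at hMv
    refine ⟨hadj huv, ?_, hMv.1⟩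
    rw [effRes_symm hpos hconn (hadj huv)]
    exact hMv.2 u (by rwa [Sym2.eq_swap])
  refine ⟨p.length, Nat.lt_succ_of_le hlen, y, ?_⟩
  by_cases hg : goodVert G c γ K δ y
  · obtain ⟨z, hzT, hz⟩ := hy.resolve_left (not_not.2 hg)
    refine Or.inr ⟨hg, z, hadj hzT, hz, hzT, hasChain_of_walk p hpath.isTrail ?_ hstep⟩
    intro e he hmem
    rw [Finset.mem_singleton] at hmem
    subst hmem
    have hzp := p.snd_mem_support_of_mem_edges he
    rw [SimpleGraph.Walk.mem_support_iff] at hzp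
    rcases hzp with hzy | hzp
    · exact (hadj hzT).ne hzy.symm
    · refine htail z hzp (Or.inr ⟨y, by rwa [Sym2.eq_swap], ?_⟩)
      rwa [effRes_symm hpos hconn (hadj hzT).symm]
  · exact Or.inl ⟨hg, hasChain_of_walk p hpath.isTrail (by simp) hstep⟩

namespace LocalLimitNetwork

variable {G : SimpleGraph V} [DecidableRel G.Adj] {c : Sym2 V → ℝ} {γ K δ : ℝ}

theorem chainSum_le (h : LocalLimitNetwork G c γ K δ) (k : ℕ) (F : Finset (Sym2 V)) (y : V) :
    chainSum G c (goodStep G c γ K δ) k F y ≤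
      treeSum G c F * ((1 + 4 * vertCond G c y / γ) * (1 + 4 * K) ^ k) := by
  classical
  have hK := h.one_lt
  induction k generalizing F y with
  | zero =>
    rw [chainSum_zero, pow_zero, mul_one]
    refine le_mul_of_one_le_right (treeSum_nonneg h.pos F) ?_
    have : 0 ≤ 4 * vertCond G c y / γ :=
      div_nonneg (mul_nonneg (by norm_num) (h.vertCond_pos y).le) h.γ_pos.le
    linarith
  | succ k ih =>
    have hB : 0 ≤ (1 + 4 * K) ^ (k + 1) := by positivity
    have hF := treeSum_nonneg h.pos F
    refine (chainSum_succ_le h.pos _ k F y).trans ?_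
    have key : ∀ u, (if goodStep G c γ K δ y u ∧ s(y, u) ∉ F then
        chainSum G c (goodStep G c γ K δ) k (insert s(y, u) F) u else 0) ≤
        condMatrix G c y u * (treeSum G c F * (4 / γ) * (1 + 4 * K) ^ (k + 1)) := by
      intro u
      have hcm := condMatrix_nonneg h.pos y u
      have hγ4 : 0 ≤ 4 / γ := (div_pos (by norm_num) h.γ_pos).le
      split_ifs with hs
      · obtain ⟨⟨hadj, hR, hg⟩, hnF⟩ := hs
        have hcu : 4 * vertCond G c u / γ ≤ 4 * K := by
          rw [div_le_iff₀ h.γ_pos]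
          linarith [hg.1.2]
        have h1 : (1 + 4 * vertCond G c u / γ) * (1 + 4 * K) ^ k ≤ (1 + 4 * K) ^ (k + 1) := by
          rw [pow_succ']
          gcongr
        have h2 : treeSum G c (insert s(y, u) F) ≤
            treeSum G c F * (condMatrix G c y u * (4 / γ)) := by
          refine (treeSum_insert_le h.pos h.connected hadj hnF).trans ?_
          refine mul_le_mul_of_nonneg_left ?_ hF
          rw [condMatrix, if_pos hadj]
          exact mul_le_mul_of_nonneg_left hR (h.pos _ hadj).le
        refine (ih _ u).trans ((mul_le_mul_of_nonneg_left h1 (treeSum_nonneg h.pos _)).trans ?_)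
        refine (mul_le_mul_of_nonneg_right h2 hB).trans (le_of_eq (by ring))
      · exact mul_nonneg hcm (mul_nonneg (mul_nonneg hF hγ4) hB)
    refine (Finset.sum_le_sum fun u _ => key u).trans ?_
    rw [← Finset.sum_mul, ← vertCond_eq_sum]
    have : treeSum G c F * ((1 + 4 * vertCond G c y / γ) * (1 + 4 * K) ^ (k + 1)) =
      vertCond G c y * (treeSum G c F * (4 / γ) * (1 + 4 * K) ^ (k + 1)) +
        treeSum G c F * (1 + 4 * K) ^ (k + 1) := by ring
    rw [this]
    exact le_add_of_nonneg_right (mul_nonneg hF hB)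

end LocalLimitNetwork

open scoped Classical in
theorem sum_not_niceBall_le {G : SimpleGraph V} [DecidableRel G.Adj]
    {c : Sym2 V → ℝ} (hpos : ∀ e ∈ G.edgeSet, 0 < c e) (hconn : G.Connected) (γ K δ : ℝ)
    (r : ℕ) :
    ∑ x : V, ∑ T ∈ spanningTrees G, (if NiceBall G c γ K δ T x r then 0 else treeWeight c T) ≤
      ∑ k ∈ Finset.range (r + 1),
        (∑ y, (if goodVert G c γ K δ y then 0 else
          chainSum G c (goodStep G c γ K δ) k ∅ y) +
        ∑ y, ∑ z, (if goodVert G c γ K δ y ∧ G.Adj y z ∧ ¬ effRes G c y z ≤ 4 / γ then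
          chainSum G c (goodStep G c γ K δ) k {s(y, z)} y else 0)) := by
  set P : Finset (V × Finset (Sym2 V)) := Finset.univ ×ˢ spanningTrees G with hP
  set a : ℕ → V → V × Finset (Sym2 V) → ℝ := fun k y p =>
    if ¬ goodVert G c γ K δ y ∧ ∅ ⊆ p.2 ∧ HasChain (goodStep G c γ K δ) p.2 k ∅ y p.1
      then treeWeight c p.2 else 0 with ha
  set b : ℕ → V → V → V × Finset (Sym2 V) → ℝ := fun k y z p =>
    if (goodVert G c γ K δ y ∧ G.Adj y z ∧ ¬ effRes G c y z ≤ 4 / γ) ∧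
      {s(y, z)} ⊆ p.2 ∧ HasChain (goodStep G c γ K δ) p.2 k {s(y, z)} y p.1
      then treeWeight c p.2 else 0 with hb
  have hA : ∀ k y, (if goodVert G c γ K δ y then 0 else
      chainSum G c (goodStep G c γ K δ) k ∅ y) = ∑ p ∈ P, a k y p := by
    intro k y
    rw [hP, Finset.sum_product]
    by_cases hg : goodVert G c γ K δ y
    · simp [ha, hg]
    · rw [if_neg hg, chainSum]
      refine Finset.sum_congr rfl fun x _ => Finset.sum_congr rfl fun T _ => ?_
      simp only [ha, hg, true_and, not_false_eq_true]
  have hB : ∀ k y z, (if goodVert G c γ K δ y ∧ G.Adj y z ∧ ¬ effRes G c y z ≤ 4 / γ then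
      chainSum G c (goodStep G c γ K δ) k {s(y, z)} y else 0) = ∑ p ∈ P, b k y z p := by
    intro k y z
    rw [hP, Finset.sum_product]
    by_cases hg : goodVert G c γ K δ y ∧ G.Adj y z ∧ ¬ effRes G c y z ≤ 4 / γ
    · rw [if_pos hg, chainSum]
      refine Finset.sum_congr rfl fun x _ => Finset.sum_congr rfl fun T _ => ?_
      simp only [hb, hg, true_and, not_false_eq_true]
    · rw [if_neg hg]
      symm
      refine Finset.sum_eq_zero fun x _ => Finset.sum_eq_zero fun T _ => ?_
      rw [hb]
      exact if_neg fun h => hg h.1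
  simp_rw [hA, hB]
  have hswap : ∑ k ∈ Finset.range (r + 1),
      (∑ y, ∑ p ∈ P, a k y p + ∑ y, ∑ z, ∑ p ∈ P, b k y z p) =
      ∑ p ∈ P, ∑ k ∈ Finset.range (r + 1), (∑ y, a k y p + ∑ y, ∑ z, b k y z p) := by
    rw [Finset.sum_comm]
    refine Finset.sum_congr rfl fun k _ => ?_
    rw [Finset.sum_add_distrib, Finset.sum_comm]
    congr 1
    rw [Finset.sum_comm' (s := P) (t' := Finset.univ) (s' := fun _ => P) (by simp)]
    exact Finset.sum_congr rfl fun y _ => Finset.sum_comm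
  rw [hswap, ← Finset.sum_product' (f := fun x T =>
    if NiceBall G c γ K δ T x r then 0 else treeWeight c T), ← hP]
  refine Finset.sum_le_sum fun p hp => ?_
  have hT : p.2 ∈ spanningTrees G := (Finset.mem_product.1 hp).2
  have hw := treeWeight_nonneg hpos hT
  have ha0 : ∀ k y, 0 ≤ a k y p := fun k y => by
    rw [ha]; dsimp only; split_ifs; exacts [hw, le_rfl]
  have hb0 : ∀ k y z, 0 ≤ b k y z p := fun k y z => by
    rw [hb]; dsimp only; split_ifs; exacts [hw, le_rfl]
  have hsa : ∀ k, 0 ≤ ∑ y, a k y p := fun k => Finset.sum_nonneg fun y _ => ha0 k y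
  have hsb' : ∀ k y, 0 ≤ ∑ z, b k y z p := fun k y => Finset.sum_nonneg fun z _ => hb0 k y z
  have hsb : ∀ k, 0 ≤ ∑ y, ∑ z, b k y z p := fun k => Finset.sum_nonneg fun y _ => hsb' k y
  split_ifs with hN
  · exact Finset.sum_nonneg fun k _ => add_nonneg (hsa k) (hsb k)
  · obtain ⟨k, hk, y, hy⟩ := exists_hasChain_of_not_niceBall hpos hconn hT hN
    refine le_trans ?_ (Finset.single_le_sum (fun k _ => add_nonneg (hsa k) (hsb k))
      (Finset.mem_range.2 hk))
    rcases hy with ⟨hg, hch⟩ | ⟨hg, z, hadj, hR, hzT, hch⟩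
    · refine le_add_of_le_of_nonneg ?_ (hsb k)
      refine le_trans (le_of_eq ?_)
        (Finset.single_le_sum (fun y _ => ha0 k y) (Finset.mem_univ y))
      exact (if_pos ⟨hg, Finset.empty_subset _, hch⟩).symm
    · refine le_add_of_nonneg_of_le (hsa k) ?_
      refine le_trans ?_ (Finset.single_le_sum (fun y _ => hsb' k y) (Finset.mem_univ y))
      refine le_trans (le_of_eq ?_)
        (Finset.single_le_sum (fun z _ => hb0 k y z) (Finset.mem_univ z))
      exact (if_pos ⟨⟨hg, hadj, hR⟩, Finset.singleton_subset_iff.2 hzT, hch⟩).symm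

theorem wstNotNiceProb_nonneg {G : SimpleGraph V} [DecidableRel G.Adj] {c : Sym2 V → ℝ}
    (hpos : ∀ e ∈ G.edgeSet, 0 < c e) (hconn : G.Connected) (γ K δ : ℝ) (r : ℕ) :
    0 ≤ wstNotNiceProb G c γ K δ r := by
  refine mul_nonneg (inv_nonneg.2 (Nat.cast_nonneg _)) (Finset.sum_nonneg fun x _ =>
    div_nonneg (Finset.sum_nonneg fun T hT => ?_) (partZ_pos hpos hconn).le)
  split_ifs
  · exact le_rfl
  · exact treeWeight_nonneg hpos hT

namespace LocalLimitNetwork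

variable {G : SimpleGraph V} [DecidableRel G.Adj] {c : Sym2 V → ℝ} {γ K δ : ℝ}

theorem wstNotNiceProb_le (h : LocalLimitNetwork G c γ K δ) (r : ℕ) :
    wstNotNiceProb G c γ K δ r ≤
      ((r + 1) * ((1 + 4 * K) ^ (r + 1) * (46 + 88 * K))) * Real.sqrt δ := by
  classical
  have hK := h.one_lt
  have hZ := partZ_pos h.pos h.connected
  set Z := partZ G c with hZdef
  set L := (1 + 4 * K) ^ (r + 1) with hL
  have hL0 : 0 ≤ L := by positivity
  have hone : 1 ≤ 1 + 4 * K := by linarith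
  have hV : 0 < (Fintype.card V : ℝ) := by
    have := h.connected.nonempty
    exact_mod_cast Fintype.card_pos
  have hbound : ∀ k ∈ Finset.range (r + 1),
      (∑ y, (if goodVert G c γ K δ y then 0 else
          chainSum G c (goodStep G c γ K δ) k ∅ y) +
        ∑ y, ∑ z, (if goodVert G c γ K δ y ∧ G.Adj y z ∧ ¬ effRes G c y z ≤ 4 / γ then
          chainSum G c (goodStep G c γ K δ) k {s(y, z)} y else 0)) ≤
      Z * (L * ((46 + 88 * K) * (Real.sqrt δ * Fintype.card V))) := by
    intro k hk
    have hk' : k ≤ r := Nat.lt_succ_iff.1 (Finset.mem_range.1 hk)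
    have hLk : (1 + 4 * K) ^ k ≤ L := pow_le_pow_right₀ hone (by omega)
    have hLk1 : (1 + 4 * K) ^ (k + 1) ≤ L := pow_le_pow_right₀ hone (by omega)
    have h1 : ∑ y, (if goodVert G c γ K δ y then 0 else
        chainSum G c (goodStep G c γ K δ) k ∅ y) ≤
        Z * (L * ((26 + 88 * K) * (Real.sqrt δ * Fintype.card V))) := by
      have : ∀ y, (if goodVert G c γ K δ y then 0 else
          chainSum G c (goodStep G c γ K δ) k ∅ y) ≤
          (Z * L) * (if goodVert G c γ K δ y then 0 else 1 + 4 * vertCond G c y / γ) := by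
        intro y
        split_ifs
        · simp
        · refine (h.chainSum_le k ∅ y).trans ?_
          have h0 : 0 ≤ 1 + 4 * vertCond G c y / γ :=
            add_nonneg zero_le_one
              (div_nonneg (mul_nonneg (by norm_num) (h.vertCond_pos y).le) h.γ_pos.le)
          rw [treeSum_empty, ← hZdef, mul_assoc, mul_comm L]
          gcongr
      refine (Finset.sum_le_sum fun y _ => this y).trans ?_
      rw [← Finset.mul_sum, ← mul_assoc Z L]
      exact mul_le_mul_of_nonneg_left h.sum_not_goodVert (mul_nonneg hZ.le hL0)
    have h2 : ∑ y, ∑ z, (if goodVert G c γ K δ y ∧ G.Adj y z ∧ ¬ effRes G c y z ≤ 4 / γ then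
        chainSum G c (goodStep G c γ K δ) k {s(y, z)} y else 0) ≤
        Z * (L * (20 * (δ * Fintype.card V))) := by
      have : ∀ y z, (if goodVert G c γ K δ y ∧ G.Adj y z ∧ ¬ effRes G c y z ≤ 4 / γ then
          chainSum G c (goodStep G c γ K δ) k {s(y, z)} y else 0) ≤
          (Z * L) * (if effRes G c y z ≤ 4 / γ then 0 else
            condMatrix G c y z * effRes G c y z) := by
        intro y z
        by_cases hyz : goodVert G c γ K δ y ∧ G.Adj y z ∧ ¬ effRes G c y z ≤ 4 / γ
        · obtain ⟨hg, hadj, hR⟩ := hyz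
          rw [if_pos ⟨hg, hadj, hR⟩, if_neg hR, condMatrix, if_pos hadj,
            mul_effRes_eq h.pos h.connected hadj, ← hZdef]
          have hcy : 1 + 4 * vertCond G c y / γ ≤ 1 + 4 * K := by
            have : 4 * vertCond G c y / γ ≤ 4 * K := by
              rw [div_le_iff₀ h.γ_pos]
              linarith [hg.1.2]
            linarith
          have hstep : (1 + 4 * vertCond G c y / γ) * (1 + 4 * K) ^ k ≤ L := by
            refine le_trans ?_ hLk1
            rw [pow_succ']
            gcongr
          refine (h.chainSum_le k _ y).trans
            ((mul_le_mul_of_nonneg_left hstep (treeSum_nonneg h.pos _)).trans (le_of_eq ?_))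
          field_simp
        · rw [if_neg hyz]
          refine mul_nonneg (mul_nonneg hZ.le hL0) ?_
          split_ifs
          · exact le_rfl
          · rw [condMatrix]
            split_ifs with hadj
            · exact mul_nonneg (h.pos _ hadj).le (effRes_pos h.pos h.connected hadj).le
            · simp
      refine (Finset.sum_le_sum fun y _ => Finset.sum_le_sum fun z _ => this y z).trans ?_
      simp_rw [← Finset.mul_sum]
      rw [← mul_assoc Z L]
      exact mul_le_mul_of_nonneg_left h.sum_bad_le (mul_nonneg hZ.le hL0)
    have h3 : Z * (L * (20 * (δ * Fintype.card V))) ≤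
        Z * (L * (20 * (Real.sqrt δ * Fintype.card V))) := by
      have := h.le_sqrt
      gcongr
    refine (add_le_add h1 (h2.trans h3)).trans (le_of_eq (by ring))
  have htotal := (sum_not_niceBall_le h.pos h.connected γ K δ r).trans (Finset.sum_le_sum hbound)
  rw [Finset.sum_const, Finset.card_range, nsmul_eq_mul] at htotal
  rw [wstNotNiceProb, ← Finset.sum_div, ← hZdef, inv_mul_le_iff₀ hV, div_le_iff₀ hZ]
  refine le_trans (le_of_eq ?_) (htotal.trans (le_of_eq ?_))
  · rfl
  · push_cast
    ring

open scoped Classical in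
theorem of_bounds {G : SimpleGraph V} [DecidableRel G.Adj] {c : Sym2 V → ℝ} {γ K δ : ℝ}
    (hconn : G.Connected) (hpos : ∀ e ∈ G.edgeSet, 0 < c e) (hK : 1 < K) (hγ : 0 < γ)
    (hδ : δ < 1)
    (hW : ((Finset.univ.filter fun v : V => vertCond G c v ∈ Set.Icc γ (K * γ)).card : ℝ)
        ≥ (1 - δ) * (Fintype.card V : ℝ))
    (hWsum : ∑ v ∈ Finset.univ.filter (fun v : V => vertCond G c v ∉ Set.Icc γ (K * γ)),
      vertCond G c v ≤ δ * γ * (Fintype.card V : ℝ))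
    (hc : ∀ e ∈ G.edgeSet, c e ≤ δ * γ) : LocalLimitNetwork G c γ K δ := by
  have hV : 0 < (Fintype.card V : ℝ) := by
    have := hconn.nonempty
    exact_mod_cast Fintype.card_pos
  have hex : ∃ v, vertCond G c v ∈ Set.Icc γ (K * γ) := by
    by_contra hcon
    push Not at hcon
    rw [Finset.filter_false_of_mem fun v _ => hcon v] at hW
    have := mul_pos (sub_pos.2 hδ) hV
    simp only [Finset.card_empty, Nat.cast_zero] at hW
    linarith
  obtain ⟨v, hv⟩ := hex
  have hex' : ∃ u, G.Adj v u := by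
    by_contra hcon
    push Not at hcon
    have h0 : vertCond G c v = 0 :=
      Finset.sum_eq_zero fun u hu => absurd ((G.mem_neighborFinset v u).1 hu) (hcon u)
    linarith [hv.1]
  obtain ⟨u, huv⟩ := hex'
  have hnt : Nontrivial V := ⟨v, u, huv.ne⟩
  have hδ0 : 0 < δ := by
    have h1 := (hpos s(v, u) huv).trans_le (hc s(v, u) huv)
    exact pos_of_mul_pos_left h1 hγ.le
  refine ⟨hconn, hpos, hK, hγ, hδ0, hδ.le, ?_, ?_, hc, fun w => ?_⟩
  swap
  · convert hWsum using 3
    exact Iff.rfl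
  · have h1 := Finset.card_filter_add_card_filter_not (s := (Finset.univ : Finset V))
      (fun v => vertCond G c v ∈ Set.Icc γ (K * γ))
    have h2 : ((Finset.univ.filter fun v : V => vertCond G c v ∈ Set.Icc γ (K * γ)).card : ℝ) +
      ((Finset.univ.filter fun v : V => ¬ vertCond G c v ∈ Set.Icc γ (K * γ)).card : ℝ) =
      Fintype.card V := by exact_mod_cast h1
    have h3 : ((Finset.univ.filter fun v => ¬ typCond G c γ K v).card : ℝ) =
      ((Finset.univ.filter fun v : V => ¬ vertCond G c v ∈ Set.Icc γ (K * γ)).card : ℝ) := by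
      congr!
    rw [h3]
    linarith
  · obtain ⟨z, hz⟩ := (G.degree_pos_iff_exists_adj w).1
      (hconn.preconnected.degree_pos_of_nontrivial w)
    refine Finset.sum_pos (fun z hz => ?_) ⟨z, (G.mem_neighborFinset w z).2 hz⟩
    exact hpos _ ((G.mem_neighborFinset w _).1 hz).symm

end LocalLimitNetwork

open scoped Classical in
/-- If `(Gₙ, cₙ)` satisfies Assumption (LL) for some `K > 1`, `γₙ > 0`,
`δₙ → 0`, with `Gₙ` simple and `cₙ` connected, then `|W̃ₙ| = (1 − O(√δₙ))|V(Gₙ)|`, and for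
`X` uniform and every fixed radius `r`, `P(B_{WST(cₙ)}(X, r)` is not nice`) → 0`. -/
theorem wst_ball_nice
    (V : ℕ → Type) [∀ n, Fintype (V n)] [∀ n, DecidableEq (V n)]
    (G : ∀ n, SimpleGraph (V n)) [∀ n, DecidableRel (G n).Adj]
    (c : ∀ n, Sym2 (V n) → ℝ) (K : ℝ) (γ : ℕ → ℝ) (δ : ℕ → ℝ)
    (hconn : ∀ n, (G n).Connected)
    (hpos : ∀ n, ∀ e ∈ (G n).edgeSet, 0 < c n e)
    (hK : 1 < K)
    (hγ : ∀ n, 0 < γ n)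
    (hδ : Tendsto δ atTop (nhds 0))
    -- Assumption (LL)(i): |Wₙ^{(tc)}| ≥ (1-δₙ)|V(Gₙ)| for all large n
    (hW : ∀ᶠ n in atTop,
      (((Finset.univ.filter fun v : V n =>
          vertCond (G n) (c n) v ∈ Set.Icc (γ n) (K * γ n)).card : ℝ))
        ≥ (1 - δ n) * (Fintype.card (V n) : ℝ))
    -- Assumption (LL)(ii): Σ_{v ∉ Wₙ^{(tc)}} C_v ≤ δₙ·γₙ·|V(Gₙ)| for all large n
    (hWsum : ∀ᶠ n in atTop,
      (∑ v ∈ Finset.univ.filter (fun v : V n =>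
          vertCond (G n) (c n) v ∉ Set.Icc (γ n) (K * γ n)), vertCond (G n) (c n) v)
        ≤ δ n * γ n * (Fintype.card (V n) : ℝ))
    -- Assumption (LL)(iii): cₙ(e) ≤ δₙ·γₙ for all edges, for all large n
    (hc : ∀ᶠ n in atTop, ∀ e ∈ (G n).edgeSet, c n e ≤ δ n * γ n)
    (r : ℕ) :
    ((fun n => (Fintype.card (V n) : ℝ) -
        (Finset.univ.filter fun v : V n => goodVert (G n) (c n) (γ n) K (δ n) v).card)
      =O[atTop] fun n => Real.sqrt (δ n) * (Fintype.card (V n) : ℝ)) ∧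
    Tendsto (fun n => wstNotNiceProb (G n) (c n) (γ n) K (δ n) r) atTop (nhds 0) := by
  have hnet : ∀ᶠ n in atTop, LocalLimitNetwork (G n) (c n) (γ n) K (δ n) := by
    filter_upwards [hW, hWsum, hc, hδ.eventually_lt_const one_pos] with n h1 h2 h3 h4
    refine LocalLimitNetwork.of_bounds (hconn n) (hpos n) hK (hγ n) h4 ?_ ?_ h3
    · convert h1
    · convert h2
  refine ⟨Asymptotics.IsBigO.of_bound 22 ?_, ?_⟩
  · filter_upwards [hnet] with n h
    have h1 := h.card_not_goodVert
    have h2 : ((Finset.univ.filter fun v => goodVert (G n) (c n) (γ n) K (δ n) v).card : ℝ) +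
        ((Finset.univ.filter fun v => ¬ goodVert (G n) (c n) (γ n) K (δ n) v).card : ℝ) =
        Fintype.card (V n) := by
      exact_mod_cast Finset.card_filter_add_card_filter_not (s := (Finset.univ : Finset (V n)))
        (fun v => goodVert (G n) (c n) (γ n) K (δ n) v)
    rw [← h2, add_sub_cancel_left, h2, Real.norm_of_nonneg (Nat.cast_nonneg _),
      Real.norm_of_nonneg (mul_nonneg (Real.sqrt_nonneg _) (Nat.cast_nonneg _))]
    exact h1
  · have hlim : Tendsto (fun n => ((r + 1) * ((1 + 4 * K) ^ (r + 1) * (46 + 88 * K))) *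
        Real.sqrt (δ n)) atTop (nhds 0) := by
      simpa using ((Real.continuous_sqrt.tendsto 0).comp hδ).const_mul
        (((r : ℝ) + 1) * ((1 + 4 * K) ^ (r + 1) * (46 + 88 * K)))
    refine squeeze_zero' (Eventually.of_forall fun n =>
      wstNotNiceProb_nonneg (hpos n) (hconn n) _ _ _ _) ?_ hlim
    filter_upwards [hnet] with n h
    exact h.wstNotNiceProb_le r

end WSTPaper
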